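/- arXiv:1610.02430 — 2 statements merged into one kernel-verified Lean document; each statement's English description precedes it below -/
import Mathlib

section
/- Let σ ⊆ ℝ³ be a 3-dimensional pointed rational polyhedral cone with e extreme rays, let C = conv((σ ∖ {0}) ∩ ℤ³), and let K be the union of the compact faces of C. Let b (resp. i) be the number of lattice points of K lying on the boundary (resp. in the interior) of σ. Then 6·λ(σ ∖ C) + e − b ≥ 2i + 1 ≥ 1, where λ is Lebesgue measure on ℝ³. (The left-hand side equals the local Euler obstruction Eu(v) of the torus-fixed point v of the affine toric 3-fold U_σ when v is an isolated singular point; hence the local Euler obstruction at any isolated singular point of a toric 3-fold X_{P∩M} is at least 1.) -/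
open MeasureTheory

/-- The standard lattice `ℤ³` inside `ℝ³`. -/
def Lat3 : Set (Fin 3 → ℝ) := {x | ∀ j, ∃ m : ℤ, x j = (m : ℝ)}

/-- `C = conv((σ ∖ {0}) ∩ ℤ³)`. -/
def hullC (σ : Set (Fin 3 → ℝ)) : Set (Fin 3 → ℝ) :=
  convexHull ℝ ((σ \ {0}) ∩ Lat3)

/-- `K` = the union of the compact (exposed) faces of `C`. -/
def compactFacesUnion (σ : Set (Fin 3 → ℝ)) : Set (Fin 3 → ℝ) :=
  ⋃₀ {F | IsExposed ℝ (hullC σ) F ∧ IsCompact F}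

/-- Standard open simplex. -/
def stdOpen : Set (Fin 3 → ℝ) := {c | (∀ i, 0 < c i) ∧ c 0 + c 1 + c 2 < 1}

/-- Open simplex spanned by `0` and three vectors. -/
def osimp (B : Fin 3 → (Fin 3 → ℝ)) : Set (Fin 3 → ℝ) :=
  {x | ∃ c ∈ stdOpen, x = ∑ i, c i • B i}

lemma vol_stdOpen : ENNReal.ofReal (1 / 6) ≤ volume stdOpen := by
  have h1 := MeasureTheory.volume_sum_rpow_lt_one (ι := Fin 3) (p := 1) le_rfl
  have hG : Real.Gamma ((3:ℝ) + 1) = 6 := by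
    have := Real.Gamma_nat_eq_factorial 3
    norm_num [Nat.factorial] at this ⊢
  have hG2 : Real.Gamma ((1:ℝ) + 1) = 1 := by
    have := Real.Gamma_nat_eq_factorial 1
    norm_num [Nat.factorial] at this ⊢
  simp only [Real.rpow_one, Fintype.card_fin, div_one, Nat.cast_ofNat, hG, hG2] at h1
  set fl : (Fin 3 → Bool) → (Fin 3 → ℝ) →ₗ[ℝ] (Fin 3 → ℝ) := fun b =>
    Matrix.toLin' (Matrix.diagonal (fun i => if b i then (1:ℝ) else -1)) with hfl
  have hdet : ∀ b, |LinearMap.det (fl b)| = 1 := by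
    intro b
    simp only [hfl, LinearMap.det_toLin', Matrix.det_diagonal, Finset.abs_prod]
    apply Finset.prod_eq_one
    intro i _
    split_ifs <;> simp
  have hcov : {x : Fin 3 → ℝ | ∑ i, |x i| < 1} ⊆
      (⋃ b : Fin 3 → Bool, fl b '' stdOpen) ∪ ⋃ i : Fin 3, {x | x i = 0} := by
    intro x hx
    by_cases h0 : ∃ i, x i = 0
    · right; simpa using h0
    · left
      push Not at h0
      simp only [Set.mem_iUnion]
      refine ⟨fun i => decide (0 < x i), fun i => |x i|, ⟨fun i => abs_pos.2 (h0 i), ?_⟩, ?_⟩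
      · simpa [Fin.sum_univ_three] using hx
      · ext i
        simp only [hfl, Matrix.toLin'_apply, Matrix.mulVec_diagonal]
        rcases lt_or_gt_of_ne (h0 i) with h | h
        · simp [not_lt.2 h.le, abs_of_neg h]
        · simp [h, abs_of_pos h]
  have hnull : volume (⋃ i : Fin 3, {x : Fin 3 → ℝ | x i = 0}) = 0 := by
    rw [measure_iUnion_null_iff]
    intro i
    exact Measure.pi_hyperplane (fun _ => (volume : Measure ℝ)) i 0
  have h2 : volume {x : Fin 3 → ℝ | ∑ i, |x i| < 1} ≤ 8 * volume stdOpen := by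
    refine (measure_mono hcov).trans ((measure_union_le _ _).trans ?_)
    rw [hnull, add_zero]
    refine (measure_iUnion_fintype_le _ _).trans ?_
    simp only [Measure.addHaar_image_linearMap, hdet]
    simp
  rw [h1] at h2
  have h3 : ENNReal.ofReal ((2 * 1) ^ 3 / 6) = 8 * ENNReal.ofReal (1 / 6) := by
    rw [show (8:ENNReal) = ENNReal.ofReal 8 by simp, ← ENNReal.ofReal_mul (by norm_num)]
    norm_num
  rw [h3] at h2
  exact (ENNReal.mul_le_mul_iff_right (by norm_num) (by norm_num)).1 h2

lemma isOpen_stdOpen : IsOpen stdOpen := by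
  have : stdOpen = (⋂ i : Fin 3, {c : Fin 3 → ℝ | 0 < c i}) ∩ {c | c 0 + c 1 + c 2 < 1} := by
    ext c; simp [stdOpen]
  rw [this]
  apply IsOpen.inter
  · exact isOpen_iInter_of_finite fun i => isOpen_lt continuous_const (continuous_apply i)
  · exact isOpen_lt (by fun_prop) continuous_const

lemma osimp_eq (B : Fin 3 → (Fin 3 → ℝ)) :
    osimp B = (Matrix.toLin' (Matrix.of B).transpose) '' stdOpen := by
  ext x
  simp only [osimp, Set.mem_ofPred_eq, Set.mem_image]
  refine exists_congr fun c => and_congr_right fun _ => ?_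
  have : (Matrix.toLin' (Matrix.of B).transpose) c = ∑ i, c i • B i := by
    ext j
    simp [Matrix.mulVec, dotProduct, Finset.sum_apply, mul_comm]
  rw [this, eq_comm]

lemma det_ne (B : Fin 3 → (Fin 3 → ℝ)) (hB : LinearIndependent ℝ B) :
    (Matrix.of B).det ≠ 0 := by
  have := (Matrix.linearIndependent_rows_iff_isUnit (A := Matrix.of B)).1 hB
  exact ((Matrix.isUnit_iff_isUnit_det _).1 this).ne_zero

lemma isOpen_osimp (B : Fin 3 → (Fin 3 → ℝ)) (hB : LinearIndependent ℝ B) : IsOpen (osimp B) := by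
  rw [osimp_eq]
  have hd : LinearMap.det (Matrix.toLin' (Matrix.of B).transpose) ≠ 0 := by
    rw [LinearMap.det_toLin', Matrix.det_transpose]; exact det_ne B hB
  have := (LinearMap.equivOfDetNeZero _ hd).toContinuousLinearEquiv.toHomeomorph.isOpenMap
  exact this _ isOpen_stdOpen

lemma vol_osimp (B : Fin 3 → (Fin 3 → ℝ)) (hB : LinearIndependent ℝ B) (hL : ∀ i, B i ∈ Lat3) :
    ENNReal.ofReal (1 / 6) ≤ volume (osimp B) := by
  rw [osimp_eq, Measure.addHaar_image_linearMap, LinearMap.det_toLin', Matrix.det_transpose]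
  choose m hm using hL
  have h1 : (Matrix.of B).det = ((Matrix.of m).det : ℤ) := by
    have : Matrix.of B = (Matrix.of m).map (Int.castRingHom ℝ) := by
      ext i j; simp [hm]
    rw [this]
    exact (RingHom.map_det (Int.castRingHom ℝ) (Matrix.of m)).symm
  have h2 : (Matrix.of m).det ≠ 0 := by
    intro h
    exact det_ne B hB (by rw [h1, h]; simp)
  have h3 : (1:ℝ) ≤ |(Matrix.of B).det| := by
    rw [h1]; exact_mod_cast Int.one_le_abs h2
  calc ENNReal.ofReal (1/6) = 1 * ENNReal.ofReal (1/6) := by rw [one_mul]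
    _ ≤ _ := mul_le_mul' (by simpa using h3) vol_stdOpen

lemma dual_vec (f : (Fin 3 → ℝ) →ₗ[ℝ] ℝ) : ∃ a : Fin 3 → ℝ, ∀ x, a ⬝ᵥ x = f x := by
  refine ⟨fun i => f (Pi.single i 1), fun x => ?_⟩
  conv_rhs => rw [pi_eq_sum_univ' x]
  simp only [map_sum, map_smul, dotProduct, smul_eq_mul]
  exact Finset.sum_congr rfl fun i _ => mul_comm _ _

lemma interp (T : Finset (Fin 3 → ℝ)) (hT : LinearIndepOn ℝ id (T : Set (Fin 3 → ℝ)))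
    (φ : (Fin 3 → ℝ) → ℝ) : ∃ a : Fin 3 → ℝ, ∀ t ∈ T, a ⬝ᵥ t = φ t := by
  let b : Module.Basis _ ℝ (Fin 3 → ℝ) := .mk (hT.linearIndepOn_extend (Set.subset_univ _)) <| by
    simpa using hT.span_extend_eq_span <| Set.subset_univ _
  obtain ⟨a, ha⟩ := dual_vec (b.constr ℝ (fun t => φ t.1))
  refine ⟨a, fun t ht => ?_⟩
  rw [ha]
  have hi : t ∈ hT.extend (Set.subset_univ _) := hT.subset_extend _ ht
  have := b.constr_basis ℝ (fun t => φ t.1) ⟨t, hi⟩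
  simpa [b] using this

/-- Improving direction. -/
lemma exists_dir (T : Finset (Fin 3 → ℝ)) (hT : LinearIndepOn ℝ id (T : Set (Fin 3 → ℝ)))
    (p d : Fin 3 → ℝ) (_hp : p ∈ T)
    (h : ¬ ∃ c : (Fin 3 → ℝ) → ℝ, (∀ t ∈ T, t ≠ p → 0 ≤ c t) ∧ d = ∑ t ∈ T, c t • t) :
    ∃ g : Fin 3 → ℝ, g ⬝ᵥ p = 0 ∧ (∀ t ∈ T, 0 ≤ g ⬝ᵥ t) ∧ g ⬝ᵥ d < 0 := by
  by_cases hd : d ∈ Submodule.span ℝ (T : Set (Fin 3 → ℝ))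
  · obtain ⟨c, hc⟩ := (Submodule.mem_span_finset (s := T)).1 hd
    have : ∃ t ∈ T, t ≠ p ∧ c t < 0 := by
      by_contra hcon
      push Not at hcon
      exact h ⟨c, hcon, hc.2.symm⟩
    obtain ⟨t0, ht0, htp, hct⟩ := this
    obtain ⟨g, hg⟩ := interp T hT (fun t => if t = t0 then 1 else 0)
    refine ⟨g, ?_, ?_, ?_⟩
    · rw [hg p _hp, if_neg (Ne.symm htp)]
    · intro t ht; rw [hg t ht]; split_ifs <;> norm_num
    · rw [← hc.2, dotProduct_sum]
      have : ∀ t ∈ T, g ⬝ᵥ (c t • t) = if t = t0 then c t0 else 0 := by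
        intro t ht
        rw [dotProduct_smul, hg t ht]
        split_ifs with h1
        · simp [h1]
        · simp
      rw [Finset.sum_congr rfl this]
      simpa [ht0] using hct
  · obtain ⟨f, hf, hk⟩ := Submodule.exists_le_ker_of_notMem hd
    have hz : ∀ t ∈ T, f t = 0 := fun t ht => hk (Submodule.subset_span ht)
    rcases lt_or_gt_of_ne hf with h1 | h1
    · obtain ⟨a, ha⟩ := dual_vec f
      exact ⟨a, by rw [ha, hz p _hp], fun t ht => by rw [ha, hz t ht], by rw [ha]; exact h1⟩
    · obtain ⟨a, ha⟩ := dual_vec (-f)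
      refine ⟨a, by rw [ha]; simp [hz p _hp], fun t ht => by rw [ha]; simp [hz t ht], ?_⟩
      rw [ha]; simpa using h1

lemma core (S : Finset (Fin 3 → ℝ)) (w : (Fin 3 → ℝ) → ℝ) (p d : Fin 3 → ℝ) (hp : p ∈ S)
    (gen : ∀ T ⊆ S, (∃ a : Fin 3 → ℝ, ∀ t ∈ T, a ⬝ᵥ t = w t) →
      LinearIndepOn ℝ id (T : Set (Fin 3 → ℝ)))
    (feas : ∃ a : Fin 3 → ℝ, a ⬝ᵥ p = w p ∧ ∀ s ∈ S, w s ≤ a ⬝ᵥ s)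
    (bd : ∃ δ : ℝ, 0 < δ ∧ ∃ ρ : ℝ, 0 < ρ ∧ ∀ a : Fin 3 → ℝ, (∀ s ∈ S, w s ≤ a ⬝ᵥ s) → ∀ j : Fin 3,
      ρ * |a j| ≤ a ⬝ᵥ (p + δ • d)) :
    ∃ (a : Fin 3 → ℝ) (T : Finset (Fin 3 → ℝ)), T ⊆ S ∧ p ∈ T ∧
      LinearIndepOn ℝ id (T : Set (Fin 3 → ℝ)) ∧
      (∀ t ∈ S, a ⬝ᵥ t = w t ↔ t ∈ T) ∧ (∀ s ∈ S, w s ≤ a ⬝ᵥ s) ∧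
      ∃ c : (Fin 3 → ℝ) → ℝ, (∀ t ∈ T, t ≠ p → 0 ≤ c t) ∧ d = ∑ t ∈ T, c t • t := by
  classical
  obtain ⟨a0, ha0p, ha0⟩ := feas
  obtain ⟨δ, hδ, ρ, hρ, hbd⟩ := bd
  let F : Set (Fin 3 → ℝ) := {a | a ⬝ᵥ p = w p ∧ (∀ s ∈ S, w s ≤ a ⬝ᵥ s) ∧ a ⬝ᵥ d ≤ a0 ⬝ᵥ d}
  have hcont : ∀ x : Fin 3 → ℝ, Continuous fun a : Fin 3 → ℝ => a ⬝ᵥ x := fun x => by fun_prop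
  have hclosed : IsClosed F := by
    have : F = {a | a ⬝ᵥ p = w p} ∩ ((⋂ s ∈ S, {a | w s ≤ a ⬝ᵥ s}) ∩ {a | a ⬝ᵥ d ≤ a0 ⬝ᵥ d}) := by
      ext a; simp [F]
    rw [this]
    refine (isClosed_eq (hcont p) continuous_const).inter (IsClosed.inter ?_ ?_)
    · exact isClosed_biInter fun s _ => isClosed_le continuous_const (hcont s)
    · exact isClosed_le (hcont d) continuous_const
  have hbdd : Bornology.IsBounded F := by
    rw [isBounded_iff_forall_norm_le]
    refine ⟨|(w p + δ * (a0 ⬝ᵥ d)) / ρ|, fun a ha => ?_⟩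
    rw [pi_norm_le_iff_of_nonneg (abs_nonneg _)]
    intro j
    refine le_trans ?_ (le_abs_self _)
    rw [Real.norm_eq_abs, le_div_iff₀ hρ, mul_comm]
    refine (hbd a ha.2.1 j).trans ?_
    rw [dotProduct_add, dotProduct_smul, ha.1, smul_eq_mul]
    have := mul_le_mul_of_nonneg_left ha.2.2 hδ.le
    linarith
  have hcomp : IsCompact F := Metric.isCompact_of_isClosed_isBounded hclosed hbdd
  obtain ⟨a, haF, hmin⟩ := hcomp.exists_isMinOn ⟨a0, ha0p, ha0, le_rfl⟩ (hcont d).continuousOn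
  refine ⟨a, S.filter (fun s => a ⬝ᵥ s = w s), Finset.filter_subset _ _,
    Finset.mem_filter.2 ⟨hp, haF.1⟩, ?_, ?_, haF.2.1, ?_⟩
  · exact gen _ (Finset.filter_subset _ _) ⟨a, fun t ht => (Finset.mem_filter.1 ht).2⟩
  · intro t ht; simp [ht]
  by_contra hcon
  have hLI := gen (S.filter (fun s => a ⬝ᵥ s = w s)) (Finset.filter_subset _ _)
    ⟨a, fun t ht => (Finset.mem_filter.1 ht).2⟩
  obtain ⟨g, hgp, hgT, hgd⟩ := exists_dir _ hLI p d (Finset.mem_filter.2 ⟨hp, haF.1⟩) hcon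
  have hev : ∀ᶠ τ : ℝ in nhdsWithin 0 (Set.Ioi 0), ∀ s ∈ S, w s ≤ (a + τ • g) ⬝ᵥ s := by
    rw [Filter.eventually_all_finset]
    intro s hs
    by_cases hst : a ⬝ᵥ s = w s
    · filter_upwards [self_mem_nhdsWithin] with τ hτ
      rw [add_dotProduct, smul_dotProduct, hst, smul_eq_mul]
      have := mul_nonneg (le_of_lt hτ) (hgT s (Finset.mem_filter.2 ⟨hs, hst⟩))
      linarith
    · have hlt : w s < a ⬝ᵥ s := lt_of_le_of_ne (haF.2.1 s hs) (Ne.symm hst)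
      have hc : Continuous fun τ : ℝ => (a + τ • g) ⬝ᵥ s := by fun_prop
      have : ∀ᶠ τ : ℝ in nhds 0, w s < (a + τ • g) ⬝ᵥ s := by
        apply hc.continuousAt.eventually (p := fun y => w s < y)
        apply lt_mem_nhds
        simpa using hlt
      exact (this.filter_mono nhdsWithin_le_nhds).mono fun _ h => h.le
  obtain ⟨τ, hτ, hτ0⟩ := (hev.and self_mem_nhdsWithin).exists
  have hτ0 : 0 < τ := hτ0
  have hlt : (a + τ • g) ⬝ᵥ d < a ⬝ᵥ d := by
    rw [add_dotProduct, smul_dotProduct, smul_eq_mul]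
    nlinarith
  have hmem : a + τ • g ∈ F := by
    refine ⟨?_, hτ, hlt.le.trans haF.2.2⟩
    rw [add_dotProduct, smul_dotProduct, hgp, haF.1]; simp
  exact absurd (hmin hmem) (not_le.2 hlt)

lemma li3 (p q r : Fin 3 → ℝ) (hpq : p ≠ q) (hpr : p ≠ r) (hqr : q ≠ r)
    (h : LinearIndepOn ℝ id (({p, q, r} : Finset (Fin 3 → ℝ)) : Set (Fin 3 → ℝ))) :
    LinearIndependent ℝ ![p, q, r] := by
  classical
  rw [Fintype.linearIndependent_iff]
  intro g hg
  have h1 := linearIndepOn_finset_iff.1 h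
    (fun x => if x = p then g 0 else if x = q then g 1 else g 2) (by
      rw [Finset.sum_insert (by simp [hpq, hpr]), Finset.sum_pair hqr]
      rw [Fin.sum_univ_three] at hg
      simpa [hpq.symm, hpr.symm, hqr.symm, add_assoc] using hg)
  have h2 := h1 p (by simp)
  have h3 := h1 q (by simp)
  have h4 := h1 r (by simp)
  simp only [if_true] at h2
  simp only [hpq.symm, if_false, if_true] at h3
  simp only [hpr.symm, hqr.symm, if_false] at h4
  intro i
  fin_cases i
  · exact h2
  · exact h3
  · exact h4

lemma core2 (S : Finset (Fin 3 → ℝ)) (w : (Fin 3 → ℝ) → ℝ) (p d m : Fin 3 → ℝ) (hp : p ∈ S)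
    (gen : ∀ T ⊆ S, (∃ a : Fin 3 → ℝ, ∀ t ∈ T, a ⬝ᵥ t = w t) →
      LinearIndepOn ℝ id (T : Set (Fin 3 → ℝ)))
    (feas : ∃ a : Fin 3 → ℝ, a ⬝ᵥ p = w p ∧ ∀ s ∈ S, w s ≤ a ⬝ᵥ s)
    (bd : ∃ δ : ℝ, 0 < δ ∧ ∃ ρ : ℝ, 0 < ρ ∧ ∀ a : Fin 3 → ℝ, (∀ s ∈ S, w s ≤ a ⬝ᵥ s) → ∀ j : Fin 3,
      ρ * |a j| ≤ a ⬝ᵥ (p + δ • d))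
    (hmp : m ⬝ᵥ p = 0) (hmd : m ⬝ᵥ d = 0)
    (hm : ∀ q ∈ S, (∀ k : ℝ, q ≠ k • p) → m ⬝ᵥ q ≠ 0) (hd : ∀ k : ℝ, d ≠ k • p) :
    ∃ q r, q ∈ S ∧ r ∈ S ∧ m ⬝ᵥ q < 0 ∧ 0 < m ⬝ᵥ r ∧ LinearIndependent ℝ ![p, q, r] ∧
      (∃ a : Fin 3 → ℝ, (∀ t ∈ S, a ⬝ᵥ t = w t ↔ (t = p ∨ t = q ∨ t = r)) ∧
        ∀ s ∈ S, w s ≤ a ⬝ᵥ s) ∧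
      ∃ α β γ : ℝ, 0 < β ∧ 0 < γ ∧ d = α • p + β • q + γ • r := by
  classical
  obtain ⟨a, T, hTS, hpT, hLI, htight, hfe, c, hc, hdc⟩ := core S w p d hp gen feas bd
  have hcard : T.card ≤ 3 := by
    have := LinearIndependent.fintype_card_le_finrank hLI
    simpa using this
  have hsum : ∑ t ∈ T.erase p, c t * (m ⬝ᵥ t) = 0 := by
    have h1 : m ⬝ᵥ d = ∑ t ∈ T, c t * (m ⬝ᵥ t) := by
      conv_lhs => rw [hdc]
      rw [dotProduct_sum]
      exact Finset.sum_congr rfl fun t _ => by rw [dotProduct_smul, smul_eq_mul]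
    rw [hmd, ← Finset.add_sum_erase _ _ hpT, hmp] at h1
    linarith
  have hpair : ∀ t ∈ T.erase p, m ⬝ᵥ t ≠ 0 := by
    intro t ht
    have htT := Finset.mem_of_mem_erase ht
    have htp := Finset.ne_of_mem_erase ht
    apply hm t (hTS htT)
    intro k hk
    have h2 := hLI.mono (t := (({p, t} : Finset (Fin 3 → ℝ)) : Set (Fin 3 → ℝ)))
      (by
        intro x hx
        rcases Finset.mem_insert.1 (Finset.mem_coe.1 hx) with h | h
        · rw [h]; exact hpT
        · rw [Finset.mem_singleton.1 h]; exact htT)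
    have h3 := linearIndepOn_finset_iff.1 h2 (fun x => if x = t then 1 else -k) (by
      rw [Finset.sum_pair htp.symm]
      simp only [if_neg htp.symm, if_true, id, one_smul, neg_smul]
      rw [← hk]; simp) t (by simp)
    simp at h3
  have hex : ∃ t ∈ T.erase p, c t * (m ⬝ᵥ t) ≠ 0 := by
    by_contra hcon
    push Not at hcon
    have h0 : ∀ t ∈ T.erase p, c t = 0 := fun t ht =>
      (mul_eq_zero.1 (hcon t ht)).resolve_right (hpair t ht)
    apply hd (c p)
    rw [hdc, ← Finset.add_sum_erase _ _ hpT, Finset.sum_eq_zero, add_zero]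
    intro t ht
    rw [h0 t ht, zero_smul]
  obtain ⟨r, hr, hr0⟩ := Finset.exists_pos_of_sum_zero_of_exists_nonzero _ hsum hex
  obtain ⟨q, hq, hq0⟩ := Finset.exists_pos_of_sum_zero_of_exists_nonzero
    (s := T.erase p) (fun t => -(c t * (m ⬝ᵥ t))) (by rw [Finset.sum_neg_distrib, hsum, neg_zero])
    (by obtain ⟨t, ht, h⟩ := hex; exact ⟨t, ht, neg_ne_zero.2 h⟩)
  have hrT := Finset.mem_of_mem_erase hr
  have hrp := Finset.ne_of_mem_erase hr
  have hqT := Finset.mem_of_mem_erase hq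
  have hqp := Finset.ne_of_mem_erase hq
  have hcr := hc r hrT hrp
  have hcq := hc q hqT hqp
  have hcr' : 0 < c r := lt_of_le_of_ne hcr (by intro h; rw [← h] at hr0; simp at hr0)
  have hcq' : 0 < c q := lt_of_le_of_ne hcq (by intro h; rw [← h] at hq0; simp at hq0)
  have hmr : 0 < m ⬝ᵥ r := by
    by_contra h; push Not at h; nlinarith
  have hmq : m ⬝ᵥ q < 0 := by
    by_contra h; push Not at h; nlinarith
  have hqr : q ≠ r := by rintro rfl; linarith
  have hTeq : T = {p, q, r} := by
    symm
    apply Finset.eq_of_subset_of_card_le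
    · intro x; simp; rintro (rfl | rfl | rfl) <;> assumption
    · rw [Finset.card_eq_three.2 ⟨p, q, r, hqp.symm, hrp.symm, hqr, rfl⟩]; exact hcard
  subst hTeq
  refine ⟨q, r, hTS hqT, hTS hrT, hmq, hmr, ?_, ⟨a, ?_, hfe⟩, c p, c q, c r, hcq', hcr', ?_⟩
  · exact li3 p q r hqp.symm hrp.symm hqr hLI
  · intro t ht; rw [htight t ht]; simp
  · rw [hdc, Finset.sum_insert (by simp [hqp.symm, hrp.symm]), Finset.sum_pair hqr, add_assoc]

lemma exists_v (S : Finset (Fin 3 → ℝ)) : ∃ v : (Fin 3 → ℝ) → ℝ, ∀ T ⊆ S,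
    ¬ LinearIndepOn ℝ id (T : Set (Fin 3 → ℝ)) →
    ∃ α : (Fin 3 → ℝ) → ℝ, ∑ t ∈ T, α t • t = 0 ∧ ∑ t ∈ T, α t * v t ≠ 0 := by
  classical
  have key : ∀ T : {T : Finset (Fin 3 → ℝ) // T ∈ S.powerset ∧
      ¬ LinearIndepOn ℝ id (T : Set (Fin 3 → ℝ))},
      ∃ α : (Fin 3 → ℝ) → ℝ, ∑ t ∈ T.1, α t • t = 0 ∧ ∃ t ∈ T.1, α t ≠ 0 := by
    rintro ⟨T, hT, hn⟩
    rw [linearIndepOn_finset_iff] at hn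
    push Not at hn
    obtain ⟨α, h1, h2⟩ := hn
    exact ⟨α, h1, h2⟩
  choose α h1 h2 using key
  have : Finite {T : Finset (Fin 3 → ℝ) // T ∈ S.powerset ∧
      ¬ LinearIndepOn ℝ id (T : Set (Fin 3 → ℝ))} :=
    Finite.of_injective (fun T => (⟨T.1, T.2.1⟩ : {T // T ∈ S.powerset})) (by
      intro T T' h
      exact Subtype.ext (congrArg (fun x : {T // T ∈ S.powerset} => x.1) h))
  obtain ⟨v, hv⟩ := Module.Dual.exists_forall_ne_zero_of_forall_exists
    (K := ℝ) (M := (Fin 3 → ℝ) → ℝ)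
    (fun T : {T : Finset (Fin 3 → ℝ) // T ∈ S.powerset ∧
      ¬ LinearIndepOn ℝ id (T : Set (Fin 3 → ℝ))} =>
      (∑ t ∈ T.1, α T t • (LinearMap.proj t : ((Fin 3 → ℝ) → ℝ) →ₗ[ℝ] ℝ))) (by
      intro T
      obtain ⟨t, ht, hne⟩ := h2 T
      refine ⟨Pi.single t 1, ?_⟩
      simp only [LinearMap.sum_apply, LinearMap.smul_apply, LinearMap.proj_apply, smul_eq_mul]
      rw [Finset.sum_eq_single t]
      · simpa using hne
      · intro b _ hb; simp [hb]
      · exact fun h => absurd ht h)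
  refine ⟨v, fun T hT hn => ⟨α ⟨T, Finset.mem_powerset.2 hT, hn⟩, h1 _, ?_⟩⟩
  simpa [LinearMap.sum_apply] using hv ⟨T, Finset.mem_powerset.2 hT, hn⟩

lemma ev_quad_ne (A B C : ℝ) (hC : C ≠ 0) :
    ∀ᶠ ε : ℝ in nhdsWithin 0 (Set.Ioi 0), A + ε * B + ε ^ 2 * C ≠ 0 := by
  by_cases hA : A = 0
  · by_cases hB : B = 0
    · filter_upwards [self_mem_nhdsWithin] with ε hε
      have hε : 0 < ε := hε
      subst hA hB
      simp [hε.ne', hC]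
    · have hc : Continuous fun ε : ℝ => B + ε * C := by fun_prop
      have : ∀ᶠ ε : ℝ in nhds 0, B + ε * C ≠ 0 := by
        apply hc.continuousAt.eventually_ne
        simpa using hB
      filter_upwards [self_mem_nhdsWithin, this.filter_mono nhdsWithin_le_nhds] with ε hε h
      have hε : 0 < ε := hε
      subst hA
      intro h0
      apply h
      have : ε * (B + ε * C) = 0 := by linarith
      exact (mul_eq_zero.1 this).resolve_left hε.ne'
  · have hc : Continuous fun ε : ℝ => A + ε * B + ε ^ 2 * C := by fun_prop
    have : ∀ᶠ ε : ℝ in nhds 0, A + ε * B + ε ^ 2 * C ≠ 0 := by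
      apply hc.continuousAt.eventually_ne
      simpa using hA
    exact this.filter_mono nhdsWithin_le_nhds

lemma ev_quad_pos (A B C : ℝ) (h : 0 < A ∨ (A = 0 ∧ 0 < B)) :
    ∀ᶠ ε : ℝ in nhdsWithin 0 (Set.Ioi 0), 0 < A + ε * B + ε ^ 2 * C := by
  rcases h with hA | ⟨hA, hB⟩
  · have hc : Continuous fun ε : ℝ => A + ε * B + ε ^ 2 * C := by fun_prop
    have : ∀ᶠ ε : ℝ in nhds 0, 0 < A + ε * B + ε ^ 2 * C := by
      apply hc.continuousAt.eventually (p := fun y => 0 < y)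
      apply lt_mem_nhds
      simpa using hA
    exact this.filter_mono nhdsWithin_le_nhds
  · have hc : Continuous fun ε : ℝ => B + ε * C := by fun_prop
    have : ∀ᶠ ε : ℝ in nhds 0, 0 < B + ε * C := by
      apply hc.continuousAt.eventually (p := fun y => 0 < y)
      apply lt_mem_nhds
      simpa using hB
    filter_upwards [self_mem_nhdsWithin, this.filter_mono nhdsWithin_le_nhds] with ε hε h
    have hε : 0 < ε := hε
    have := mul_pos hε h
    subst hA
    linarith

lemma interp3 (B : Fin 3 → (Fin 3 → ℝ)) (hB : LinearIndependent ℝ B) (y : Fin 3 → ℝ) :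
    ∃ a : Fin 3 → ℝ, ∀ i, a ⬝ᵥ B i = y i := by
  have hu : IsUnit (Matrix.of B) := Matrix.linearIndependent_rows_iff_isUnit.1 hB
  obtain ⟨a, ha⟩ := (Matrix.mulVec_surjective_iff_isUnit.2 hu) y
  refine ⟨a, fun i => ?_⟩
  rw [← ha, dotProduct_comm]; rfl

lemma uniq3 (B : Fin 3 → (Fin 3 → ℝ)) (hB : LinearIndependent ℝ B) (a a' : Fin 3 → ℝ)
    (h : ∀ i, a ⬝ᵥ B i = a' ⬝ᵥ B i) : a = a' := by
  have hu : IsUnit (Matrix.of B) := Matrix.linearIndependent_rows_iff_isUnit.1 hB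
  apply Matrix.mulVec_injective_iff_isUnit.2 hu
  ext i
  have := h i
  rw [dotProduct_comm, dotProduct_comm a'] at this
  exact this

lemma exists_w (S P : Finset (Fin 3 → ℝ))
    (hP : ∀ p ∈ P, ∃ f : Fin 3 → ℝ, f ⬝ᵥ p = 1 ∧ ∀ s ∈ S, 1 ≤ f ⬝ᵥ s) :
    ∃ w : (Fin 3 → ℝ) → ℝ, (∀ s ∈ S, 0 < w s) ∧
    (∀ T ⊆ S, (∃ a : Fin 3 → ℝ, ∀ t ∈ T, a ⬝ᵥ t = w t) →
      LinearIndepOn ℝ id (T : Set (Fin 3 → ℝ))) ∧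
    (∀ p ∈ P, ∃ a : Fin 3 → ℝ, a ⬝ᵥ p = w p ∧ ∀ s ∈ S, w s ≤ a ⬝ᵥ s) ∧
    (∀ p ∈ S, ∀ q ∈ S, ∀ r ∈ S, LinearIndependent ℝ ![p, q, r] → ∀ a : Fin 3 → ℝ,
      (∀ i, a ⬝ᵥ (![p, q, r] i) = w (![p, q, r] i)) → (∀ s ∈ S, w s ≤ a ⬝ᵥ s) →
      ∃ b : Fin 3 → ℝ, (∀ i, b ⬝ᵥ (![p, q, r] i) = 1) ∧ ∀ s ∈ S, 1 ≤ b ⬝ᵥ s) := by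
  classical
  obtain ⟨v, hv⟩ := exists_v S
  let W : ℝ → (Fin 3 → ℝ) → ℝ := fun ε s => 1 + ε * (-(s ⬝ᵥ s)) + ε ^ 2 * v s
  have e1 : ∀ᶠ ε : ℝ in nhdsWithin 0 (Set.Ioi 0), ∀ s ∈ S, 0 < W ε s := by
    rw [Filter.eventually_all_finset]
    intro s _
    exact ev_quad_pos 1 _ _ (Or.inl one_pos)
  have e2 : ∀ᶠ ε : ℝ in nhdsWithin 0 (Set.Ioi 0), ∀ T ∈ S.powerset,
      (∃ a : Fin 3 → ℝ, ∀ t ∈ T, a ⬝ᵥ t = W ε t) →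
      LinearIndepOn ℝ id (T : Set (Fin 3 → ℝ)) := by
    rw [Filter.eventually_all_finset]
    intro T hT
    by_cases hLI : LinearIndepOn ℝ id (T : Set (Fin 3 → ℝ))
    · exact Filter.Eventually.of_forall fun _ _ => hLI
    · obtain ⟨α, h1, h2⟩ := hv T (Finset.mem_powerset.1 hT) hLI
      filter_upwards [ev_quad_ne (∑ t ∈ T, α t) (∑ t ∈ T, α t * (-(t ⬝ᵥ t))) _ h2] with ε hε
      rintro ⟨a, ha⟩
      exfalso
      apply hε
      have h3 : a ⬝ᵥ (∑ t ∈ T, α t • t) = 0 := by rw [h1]; simp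
      rw [dotProduct_sum] at h3
      rw [← h3, Finset.mul_sum, Finset.mul_sum, ← Finset.sum_add_distrib,
        ← Finset.sum_add_distrib]
      refine Finset.sum_congr rfl fun t ht => ?_
      rw [dotProduct_smul, ha t ht, smul_eq_mul]
      simp only [W]
      ring
  have e3 : ∀ᶠ ε : ℝ in nhdsWithin 0 (Set.Ioi 0), ∀ p ∈ P,
      ∃ a : Fin 3 → ℝ, a ⬝ᵥ p = W ε p ∧ ∀ s ∈ S, W ε s ≤ a ⬝ᵥ s := by
    rw [Filter.eventually_all_finset]
    intro p hp
    obtain ⟨f, hfp, hf⟩ := hP p hp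
    have : ∀ᶠ ε : ℝ in nhdsWithin 0 (Set.Ioi 0), ∀ s ∈ S, s ≠ p →
        0 < (f ⬝ᵥ s - 1) + ε * ((p ⬝ᵥ p) * (f ⬝ᵥ s) - 2 * (p ⬝ᵥ s) + s ⬝ᵥ s)
          + ε ^ 2 * (v p * (f ⬝ᵥ s) - v s) := by
      rw [Filter.eventually_all_finset]
      intro s hs
      by_cases hsp : s = p
      · exact Filter.Eventually.of_forall fun _ h => absurd hsp h
      · have := ev_quad_pos (f ⬝ᵥ s - 1) ((p ⬝ᵥ p) * (f ⬝ᵥ s) - 2 * (p ⬝ᵥ s) + s ⬝ᵥ s)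
          (v p * (f ⬝ᵥ s) - v s) (by
          rcases (hf s hs).lt_or_eq with h | h
          · left; linarith
          · right
            refine ⟨by linarith, ?_⟩
            rw [← h]
            have h5 : 0 < (s - p) ⬝ᵥ (s - p) := by
              have h6 : (s - p) ⬝ᵥ (s - p) ≠ 0 := by
                rw [Ne, dotProduct_self_eq_zero, sub_eq_zero]; exact hsp
              have h7 : 0 ≤ (s - p) ⬝ᵥ (s - p) :=
                Finset.sum_nonneg fun i _ => mul_self_nonneg _
              exact lt_of_le_of_ne h7 h6.symm
            rw [sub_dotProduct, dotProduct_sub, dotProduct_sub, dotProduct_comm s p] at h5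
            linarith)
        exact this.mono fun _ h _ => h
    filter_upwards [this] with ε hε
    refine ⟨f + ε • ((p ⬝ᵥ p) • f - (2:ℝ) • p) + (ε ^ 2 * v p) • f, ?_, fun s hs => ?_⟩
    · simp only [add_dotProduct, smul_dotProduct, sub_dotProduct, smul_eq_mul, hfp, W]
      ring
    · by_cases hsp : s = p
      · subst hsp
        simp only [add_dotProduct, smul_dotProduct, sub_dotProduct, smul_eq_mul, hfp, W]
        apply le_of_eq; ring
      · have := hε s hs hsp
        simp only [add_dotProduct, smul_dotProduct, sub_dotProduct, smul_eq_mul, W]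
        linarith
  have e4 : ∀ᶠ ε : ℝ in nhdsWithin 0 (Set.Ioi 0), ∀ p ∈ S, ∀ q ∈ S, ∀ r ∈ S,
      LinearIndependent ℝ ![p, q, r] → ∀ a : Fin 3 → ℝ,
      (∀ i, a ⬝ᵥ (![p, q, r] i) = W ε (![p, q, r] i)) → (∀ s ∈ S, W ε s ≤ a ⬝ᵥ s) →
      ∃ b : Fin 3 → ℝ, (∀ i, b ⬝ᵥ (![p, q, r] i) = 1) ∧ ∀ s ∈ S, 1 ≤ b ⬝ᵥ s := by
    simp only [Filter.eventually_all_finset]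
    intro p hp q hq r hr
    by_cases hB : LinearIndependent ℝ ![p, q, r]
    swap
    · exact Filter.Eventually.of_forall fun _ h => absurd h hB
    generalize hBdef : ![p, q, r] = B at hB
    obtain ⟨a1, h1⟩ := interp3 B hB (fun _ => 1)
    obtain ⟨a2, h2⟩ := interp3 B hB (fun i => -(B i ⬝ᵥ B i))
    obtain ⟨a3, h3⟩ := interp3 B hB (fun i => v (B i))
    by_cases hall : ∀ s ∈ S, 1 ≤ a1 ⬝ᵥ s
    · exact Filter.Eventually.of_forall fun _ _ _ _ _ => ⟨a1, h1, hall⟩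
    push Not at hall
    obtain ⟨s, hs, hlt⟩ := hall
    filter_upwards [ev_quad_pos (1 - a1 ⬝ᵥ s) (-(s ⬝ᵥ s) - a2 ⬝ᵥ s) (v s - a3 ⬝ᵥ s)
      (Or.inl (by linarith))] with ε hε _ a ha hfe
    exfalso
    have heq : a = a1 + ε • a2 + ε ^ 2 • a3 := by
      apply uniq3 B hB
      intro i
      rw [ha i]
      simp only [add_dotProduct, smul_dotProduct, smul_eq_mul, h1, h2, h3, W]
    have := hfe s hs
    rw [heq] at this
    simp only [add_dotProduct, smul_dotProduct, smul_eq_mul, W] at this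
    linarith
  obtain ⟨ε, h1, h2, h3, h4⟩ := (e1.and (e2.and (e3.and e4))).exists
  exact ⟨W ε, h1, fun T hT => h2 T (Finset.mem_powerset.2 hT), h3, h4⟩

lemma tight_of_meet (S : Finset (Fin 3 → ℝ)) (w : (Fin 3 → ℝ) → ℝ) (B B' : Fin 3 → (Fin 3 → ℝ))
    (hB : ∀ i, B i ∈ S) (hB' : ∀ i, B' i ∈ S) (a a' : Fin 3 → ℝ)
    (ha : ∀ i, a ⬝ᵥ B i = w (B i)) (ha' : ∀ i, a' ⬝ᵥ B' i = w (B' i))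
    (hf : ∀ s ∈ S, w s ≤ a ⬝ᵥ s) (hf' : ∀ s ∈ S, w s ≤ a' ⬝ᵥ s)
    (x : Fin 3 → ℝ) (hx : x ∈ osimp B) (hx' : x ∈ osimp B') :
    ∀ i, a' ⬝ᵥ B i = w (B i) := by
  obtain ⟨c, ⟨hc, _⟩, hxc⟩ := hx
  obtain ⟨c', ⟨hc', _⟩, hxc'⟩ := hx'
  have e1 : a ⬝ᵥ x = ∑ i, c i * w (B i) := by
    rw [hxc, dotProduct_sum]
    exact Finset.sum_congr rfl fun i _ => by rw [dotProduct_smul, ha, smul_eq_mul]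
  have e2 : a' ⬝ᵥ x = ∑ i, c i * (a' ⬝ᵥ B i) := by
    rw [hxc, dotProduct_sum]
    exact Finset.sum_congr rfl fun i _ => by rw [dotProduct_smul, smul_eq_mul]
  have e3 : a' ⬝ᵥ x = ∑ i, c' i * w (B' i) := by
    rw [hxc', dotProduct_sum]
    exact Finset.sum_congr rfl fun i _ => by rw [dotProduct_smul, ha', smul_eq_mul]
  have e4 : a ⬝ᵥ x = ∑ i, c' i * (a ⬝ᵥ B' i) := by
    rw [hxc', dotProduct_sum]
    exact Finset.sum_congr rfl fun i _ => by rw [dotProduct_smul, smul_eq_mul]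
  have l1 : a' ⬝ᵥ x ≤ a ⬝ᵥ x := by
    rw [e3, e4]
    exact Finset.sum_le_sum fun i _ => mul_le_mul_of_nonneg_left (hf _ (hB' i)) (hc' i).le
  have l2 : ∀ i ∈ Finset.univ, c i * w (B i) ≤ c i * (a' ⬝ᵥ B i) := fun i _ =>
    mul_le_mul_of_nonneg_left (hf' _ (hB i)) (hc i).le
  have l3 : ∑ i, c i * w (B i) = ∑ i, c i * (a' ⬝ᵥ B i) := by
    apply le_antisymm (Finset.sum_le_sum l2)
    rw [← e1, ← e2]; exact l1
  have l4 := (Finset.sum_eq_sum_iff_of_le l2).1 l3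
  intro i
  exact (mul_left_cancel₀ (hc i).ne' (l4 i (Finset.mem_univ i))).symm

lemma bool_sum (b b' : Bool) (h : ¬ b = b') (x : Fin 3 → ℝ) :
    (if b then x else -x) + (if b' then x else -x) = 0 := by
  cases b <;> cases b' <;> simp at h ⊢

lemma vol_bound (S : Finset (Fin 3 → ℝ)) (w : (Fin 3 → ℝ) → ℝ) (h l : Fin 3 → ℝ)
    (R : Set (Fin 3 → ℝ)) (J : Finset ((Fin 3 → ℝ) × Bool)) (D : (Fin 3 → ℝ) → (Fin 3 → ℝ))
    (hS : ∀ s ∈ S, s ∈ Lat3)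
    (gen : ∀ T ⊆ S, (∃ a : Fin 3 → ℝ, ∀ t ∈ T, a ⬝ᵥ t = w t) →
      LinearIndepOn ℝ id (T : Set (Fin 3 → ℝ)))
    (hlim : ∀ p ∈ S, ∀ q ∈ S, ∀ r ∈ S, LinearIndependent ℝ ![p, q, r] → ∀ a : Fin 3 → ℝ,
      (∀ i, a ⬝ᵥ (![p, q, r] i) = w (![p, q, r] i)) → (∀ s ∈ S, w s ≤ a ⬝ᵥ s) →
      ∃ b : Fin 3 → ℝ, (∀ i, b ⬝ᵥ (![p, q, r] i) = 1) ∧ ∀ s ∈ S, 1 ≤ b ⬝ᵥ s)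
    (hh : ∀ s ∈ S, 0 < h ⬝ᵥ s)
    (hl : ∀ p ∈ S, ∀ q ∈ S, (∀ k : ℝ, q ≠ k • p) → (h ⬝ᵥ p) * (l ⬝ᵥ q) - (l ⬝ᵥ p) * (h ⬝ᵥ q) ≠ 0)
    (hR : ∀ B : Fin 3 → (Fin 3 → ℝ), (∀ i, B i ∈ S) →
      (∃ b : Fin 3 → ℝ, (∀ i, b ⬝ᵥ B i = 1) ∧ ∀ s ∈ S, 1 ≤ b ⬝ᵥ s) → osimp B ⊆ R)
    (hJ : ∀ j ∈ J, j.1 ∈ S ∧ (∃ a : Fin 3 → ℝ, a ⬝ᵥ j.1 = w j.1 ∧ ∀ s ∈ S, w s ≤ a ⬝ᵥ s) ∧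
      (∃ δ : ℝ, 0 < δ ∧ ∃ ρ : ℝ, 0 < ρ ∧ ∀ a : Fin 3 → ℝ, (∀ s ∈ S, w s ≤ a ⬝ᵥ s) →
        ∀ i : Fin 3, ρ * |a i| ≤ a ⬝ᵥ (j.1 + δ • (if j.2 then D j.1 else -D j.1))) ∧
      (h ⬝ᵥ j.1) * (l ⬝ᵥ D j.1) - (l ⬝ᵥ j.1) * (h ⬝ᵥ D j.1) = 0 ∧ (∀ k : ℝ, D j.1 ≠ k • j.1)) :
    (J.card : ENNReal) * ENNReal.ofReal (1 / 6) ≤ volume R := by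
  classical
  have key : ∀ j : J, ∃ q r, q ∈ S ∧ r ∈ S ∧ (h ⬝ᵥ j.1.1) * (l ⬝ᵥ q) - (l ⬝ᵥ j.1.1) * (h ⬝ᵥ q) < 0 ∧
      0 < (h ⬝ᵥ j.1.1) * (l ⬝ᵥ r) - (l ⬝ᵥ j.1.1) * (h ⬝ᵥ r) ∧
      LinearIndependent ℝ ![j.1.1, q, r] ∧
      (∃ a : Fin 3 → ℝ, (∀ t ∈ S, a ⬝ᵥ t = w t ↔ (t = j.1.1 ∨ t = q ∨ t = r)) ∧
        ∀ s ∈ S, w s ≤ a ⬝ᵥ s) ∧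
      ∃ α β γ : ℝ, 0 < β ∧ 0 < γ ∧
        (if j.1.2 then D j.1.1 else -D j.1.1) = α • j.1.1 + β • q + γ • r := by
    rintro ⟨⟨p, s⟩, hj⟩
    obtain ⟨hp, hfe, hbd, hm, hD⟩ := hJ _ hj
    have hdot : ∀ x, ((h ⬝ᵥ p) • l - (l ⬝ᵥ p) • h) ⬝ᵥ x =
        (h ⬝ᵥ p) * (l ⬝ᵥ x) - (l ⬝ᵥ p) * (h ⬝ᵥ x) := by
      intro x; rw [sub_dotProduct, smul_dotProduct, smul_dotProduct, smul_eq_mul, smul_eq_mul]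
    have := core2 S w p (if s then D p else -D p) ((h ⬝ᵥ p) • l - (l ⬝ᵥ p) • h) hp gen hfe hbd
      (by rw [hdot]; ring)
      (by
        cases s
        · simp only [Bool.false_eq_true, if_false, dotProduct_neg, hdot]
          have hm2 : (h ⬝ᵥ p) * (l ⬝ᵥ D p) - (l ⬝ᵥ p) * (h ⬝ᵥ D p) = 0 := hm
          linarith
        · simp only [if_true, hdot]; exact hm)
      (by intro q hq hk; rw [hdot]; exact hl p hp q hq hk)
      (by
        intro k
        cases s
        · simp only [Bool.false_eq_true, if_false]
          intro hk
          apply hD (-k)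
          rw [neg_smul, ← hk, neg_neg]
        · simpa using hD k)
    simp only [hdot] at this
    exact this
  choose q r hq hr hmq hmr hLI hA hdec using key
  choose a htight hfe using hA
  let B : J → Fin 3 → (Fin 3 → ℝ) := fun j => ![j.1.1, q j, r j]
  have hpS : ∀ j : J, j.1.1 ∈ S := fun j => (hJ _ j.2).1
  have hBS : ∀ j i, B j i ∈ S := by
    intro j i
    fin_cases i
    · exact hpS j
    · exact hq j
    · exact hr j
  have hBw : ∀ j i, a j ⬝ᵥ B j i = w (B j i) := by
    intro j i
    rw [htight j _ (hBS j i)]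
    fin_cases i <;> simp [B]
  have hdisj : Pairwise (Function.onFun Disjoint fun j => osimp (B j)) := by
    intro j j' hne
    rw [Function.onFun, Set.disjoint_left]
    intro x hx hx'
    apply hne
    have t1 := tight_of_meet S w (B j) (B j') (hBS j) (hBS j') (a j) (a j') (hBw j) (hBw j')
      (hfe j) (hfe j') x hx hx'
    have t2 : ∀ i, B j i = j'.1.1 ∨ B j i = q j' ∨ B j i = r j' := fun i =>
      (htight j' _ (hBS j i)).1 (t1 i)
    have c0 : j.1.1 = j'.1.1 ∨ j.1.1 = q j' ∨ j.1.1 = r j' := t2 0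
    have c1 : q j = j'.1.1 ∨ q j = q j' ∨ q j = r j' := t2 1
    have c2 : r j = j'.1.1 ∨ r j = q j' ∨ r j = r j' := t2 2
    have ord : ∀ u v : Fin 3 → ℝ, u ∈ S → v ∈ S → ((h ⬝ᵥ u) * (l ⬝ᵥ v) - (l ⬝ᵥ u) * (h ⬝ᵥ v) < 0 ↔
        (l ⬝ᵥ v) / (h ⬝ᵥ v) < (l ⬝ᵥ u) / (h ⬝ᵥ u)) := by
      intro u v hu hv
      rw [div_lt_div_iff₀ (hh v hv) (hh u hu), sub_neg, mul_comm (h ⬝ᵥ u)]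
    have o1 := (ord _ _ (hpS j) (hq j)).1 (hmq j)
    have o2 := (ord _ _ (hr j) (hpS j)).1 (by linarith [hmr j])
    have o3 := (ord _ _ (hpS j') (hq j')).1 (hmq j')
    have o4 := (ord _ _ (hr j') (hpS j')).1 (by linarith [hmr j'])
    have hpp : j.1.1 = j'.1.1 ∧ q j = q j' ∧ r j = r j' := by
      rcases c0 with c0 | c0 | c0 <;> rcases c1 with c1 | c1 | c1 <;>
        rcases c2 with c2 | c2 | c2 <;> rw [c0, c1] at o1 <;> rw [c0, c2] at o2 <;>
        first
        | exact ⟨c0, c1, c2⟩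
        | (exfalso; linarith)
    obtain ⟨e0, e1, e2⟩ := hpp
    obtain ⟨α, β, γ, hβ, hγ, hd⟩ := hdec j
    obtain ⟨α', β', γ', hβ', hγ', hd'⟩ := hdec j'
    rw [← e0, ← e1, ← e2] at hd'
    have hbool : j.1.2 = j'.1.2 := by
      by_contra hb
      have hzero : (α + α') • j.1.1 + (β + β') • q j + (γ + γ') • r j = 0 := by
        have : (if j.1.2 then D j.1.1 else -D j.1.1) + (if j'.1.2 then D j.1.1 else -D j.1.1) = 0 :=
          bool_sum _ _ hb _
        rw [hd, hd'] at this
        rw [← this]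
        module
      have := Fintype.linearIndependent_iff.1 (hLI j) ![α + α', β + β', γ + γ'] (by
        rw [Fin.sum_univ_three]; simpa using hzero) 1
      simp at this
      linarith
    exact Subtype.ext (Prod.ext e0 hbool)
  have hsub : (⋃ j : J, osimp (B j)) ⊆ R := by
    apply Set.iUnion_subset
    intro j
    exact hR (B j) (hBS j) (hlim _ (hpS j) _ (hq j) _ (hr j) (hLI j) (a j) (hBw j) (hfe j))
  refine le_trans ?_ (measure_mono hsub)
  rw [measure_iUnion hdisj (fun j => (isOpen_osimp _ (hLI j)).measurableSet), tsum_fintype]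
  calc (J.card : ENNReal) * ENNReal.ofReal (1 / 6)
      = ∑ _j : J, ENNReal.ofReal (1 / 6) := by simp
    _ ≤ _ := Finset.sum_le_sum fun j _ => vol_osimp _ (hLI j) fun i => hS _ (hBS j i)

/-- The cone spanned by a family. -/
def coneOf {e : ℕ} (u : Fin e → (Fin 3 → ℝ)) : Set (Fin 3 → ℝ) :=
  {x | ∃ c : Fin e → ℝ, (∀ i, 0 ≤ c i) ∧ x = ∑ i, c i • u i}

lemma cone_add {e : ℕ} (u : Fin e → (Fin 3 → ℝ)) {x y : Fin 3 → ℝ} (hx : x ∈ coneOf u)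
    (hy : y ∈ coneOf u) : x + y ∈ coneOf u := by
  obtain ⟨c, hc, rfl⟩ := hx
  obtain ⟨c', hc', rfl⟩ := hy
  refine ⟨fun i => c i + c' i, fun i => add_nonneg (hc i) (hc' i), ?_⟩
  simp only [add_smul, Finset.sum_add_distrib]

lemma cone_smul {e : ℕ} (u : Fin e → (Fin 3 → ℝ)) {x : Fin 3 → ℝ} (hx : x ∈ coneOf u)
    {t : ℝ} (ht : 0 ≤ t) : t • x ∈ coneOf u := by
  obtain ⟨c, hc, rfl⟩ := hx
  refine ⟨fun i => t * c i, fun i => mul_nonneg ht (hc i), ?_⟩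
  simp only [mul_smul, Finset.smul_sum]

lemma cone_gen {e : ℕ} (u : Fin e → (Fin 3 → ℝ)) (i : Fin e) : u i ∈ coneOf u := by
  classical
  refine ⟨Pi.single i 1, fun j => ?_, ?_⟩
  · by_cases h : j = i
    · subst h; simp
    · simp [h]
  · rw [Finset.sum_eq_single i]
    · simp
    · intro j _ h; simp [h]
    · simp

lemma cone_sub_gen {e : ℕ} (u : Fin e → (Fin 3 → ℝ)) (c : Fin e → ℝ) (hc : ∀ i, 0 ≤ c i)
    (i : Fin e) (hi : 1 ≤ c i) : ∃ y ∈ coneOf u, ∑ j, c j • u j = u i + y := by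
  classical
  refine ⟨∑ j, (c j - if j = i then 1 else 0) • u j, ⟨_, fun j => ?_, rfl⟩, ?_⟩
  · split_ifs with h
    · subst h; linarith
    · simpa using hc j
  · simp only [sub_smul, Finset.sum_sub_distrib, ite_smul, one_smul, zero_smul]
    simp

lemma cone_nonneg {e : ℕ} (u : Fin e → (Fin 3 → ℝ)) (a : Fin 3 → ℝ) (ha : ∀ i, 0 ≤ a ⬝ᵥ u i)
    {x : Fin 3 → ℝ} (hx : x ∈ coneOf u) : 0 ≤ a ⬝ᵥ x := by
  obtain ⟨c, hc, rfl⟩ := hx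
  rw [dotProduct_sum]
  refine Finset.sum_nonneg fun i _ => ?_
  rw [dotProduct_smul]
  exact mul_nonneg (hc i) (ha i)

lemma cone_interior {e : ℕ} (u : Fin e → (Fin 3 → ℝ)) {x y : Fin 3 → ℝ} (hx : x ∈ coneOf u)
    (hy : y ∈ interior (coneOf u)) {s t : ℝ} (hs : 0 ≤ s) (ht : 0 < t) :
    s • x + t • y ∈ interior (coneOf u) := by
  have hopen : IsOpen ((fun z : Fin 3 → ℝ => s • x + t • z) '' interior (coneOf u)) := by
    have h1 : IsOpen ((fun z : Fin 3 → ℝ => t • z) '' interior (coneOf u)) :=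
      (isOpenMap_smul₀ ht.ne') _ isOpen_interior
    have h2 := (isOpenMap_add_left (s • x)) _ h1
    rwa [Set.image_image] at h2
  refine interior_maximal ?_ hopen ⟨y, hy, rfl⟩
  rintro _ ⟨z, hz, rfl⟩
  exact cone_add u (cone_smul u hx hs) (cone_smul u (interior_subset hz) ht.le)

lemma lat_add {x y : Fin 3 → ℝ} (hx : x ∈ Lat3) (hy : y ∈ Lat3) : x + y ∈ Lat3 := by
  intro j
  obtain ⟨m, hm⟩ := hx j
  obtain ⟨n, hn⟩ := hy j
  exact ⟨m + n, by simp [hm, hn]⟩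

lemma lat_nsmul {x : Fin 3 → ℝ} (hx : x ∈ Lat3) (N : ℕ) : (N : ℝ) • x ∈ Lat3 := by
  intro j
  obtain ⟨m, hm⟩ := hx j
  exact ⟨N * m, by simp [hm]⟩

lemma hull_add_gen {e : ℕ} (u : Fin e → (Fin 3 → ℝ)) (hu : ∀ i, u i ∈ Lat3)
    (hpt : ∀ x ∈ coneOf u, -x ∈ coneOf u → x = 0) (i : Fin e) (t : ℝ) (ht : 0 ≤ t)
    (x : Fin 3 → ℝ) (hx : x ∈ hullC (coneOf u)) : x + t • u i ∈ hullC (coneOf u) := by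
  have hconv : Convex ℝ (hullC (coneOf u)) := convex_convexHull ℝ _
  have hsub : hullC (coneOf u) ⊆ {x | x + t • u i ∈ hullC (coneOf u)} := by
    refine convexHull_min ?_ ?_
    · rintro q ⟨⟨hq, hq0⟩, hql⟩
      have hq0 : q ≠ 0 := hq0
      have hqC : q ∈ hullC (coneOf u) := subset_convexHull ℝ _ ⟨⟨hq, hq0⟩, hql⟩
      obtain ⟨N, hN⟩ := exists_nat_gt t
      have hN0 : (0:ℝ) < N := lt_of_le_of_lt ht hN
      have hq2 : q + (N:ℝ) • u i ∈ hullC (coneOf u) := by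
        refine subset_convexHull ℝ _ ⟨⟨cone_add u hq (cone_smul u (cone_gen u i) hN0.le), ?_⟩,
          lat_add hql (lat_nsmul (hu i) N)⟩
        intro h
        apply hq0
        apply hpt q hq
        have : -q = (N:ℝ) • u i := by
          have h : q + (N:ℝ) • u i = 0 := h
          exact neg_eq_of_add_eq_zero_right h
        rw [this]
        exact cone_smul u (cone_gen u i) hN0.le
      have := hconv hqC hq2 (a := 1 - t / N) (b := t / N)
        (by rw [sub_nonneg, div_le_one hN0]; exact hN.le) (by positivity) (by ring)
      have heq : (1 - t / N) • q + (t / N) • (q + (N:ℝ) • u i) = q + t • u i := by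
        rw [smul_add, smul_smul, div_mul_cancel₀ _ hN0.ne']
        module
      rw [heq] at this
      exact this
    · have := hconv.translate_preimage_left (t • u i)
      exact this
  exact hsub hx

lemma hull_add {e : ℕ} (u : Fin e → (Fin 3 → ℝ)) (hu : ∀ i, u i ∈ Lat3)
    (hpt : ∀ x ∈ coneOf u, -x ∈ coneOf u → x = 0)
    (x y : Fin 3 → ℝ) (hx : x ∈ hullC (coneOf u)) (hy : y ∈ coneOf u) :
    x + y ∈ hullC (coneOf u) := by
  classical
  obtain ⟨c, hc, rfl⟩ := hy
  have : ∀ s : Finset (Fin e), x + ∑ i ∈ s, c i • u i ∈ hullC (coneOf u) := by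
    intro s
    induction s using Finset.induction_on with
    | empty => simpa using hx
    | insert i s hi ih =>
      rw [Finset.sum_insert hi, add_comm (c i • u i), ← add_assoc]
      exact hull_add_gen u hu hpt i (c i) (hc i) _ ih
  exact this Finset.univ

lemma hull_sub {e : ℕ} (u : Fin e → (Fin 3 → ℝ))
    (hpt : ∀ x ∈ coneOf u, -x ∈ coneOf u → x = 0) : hullC (coneOf u) ⊆ coneOf u \ {0} := by
  refine convexHull_min Set.inter_subset_left ?_
  rintro x ⟨hx, hx0⟩ y ⟨hy, hy0⟩ a b ha hb hab
  refine ⟨cone_add u (cone_smul u hx ha) (cone_smul u hy hb), ?_⟩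
  intro h
  have h : a • x + b • y = 0 := h
  have h1 : a • x = 0 := by
    apply hpt _ (cone_smul u hx ha)
    rw [neg_eq_of_add_eq_zero_right h]
    exact cone_smul u hy hb
  have h2 : b • y = 0 := by rwa [h1, zero_add] at h
  have hx0 : x ≠ 0 := hx0
  have hy0 : y ≠ 0 := hy0
  have := (smul_eq_zero.1 h1).resolve_right hx0
  have := (smul_eq_zero.1 h2).resolve_right hy0
  linarith

lemma K_point {e : ℕ} (u : Fin e → (Fin 3 → ℝ)) (hu : ∀ i, u i ∈ Lat3)
    (hpt : ∀ x ∈ coneOf u, -x ∈ coneOf u → x = 0) (p : Fin 3 → ℝ)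
    (hp : p ∈ compactFacesUnion (coneOf u)) :
    p ∈ coneOf u ∧ p ≠ 0 ∧ ∃ f : Fin 3 → ℝ, f ⬝ᵥ p = 1 ∧ (∀ y ∈ hullC (coneOf u), 1 ≤ f ⬝ᵥ y) ∧
      ∀ x ∈ coneOf u, x ≠ 0 → 0 < f ⬝ᵥ x := by
  obtain ⟨F, ⟨hF, hFc⟩, hpF⟩ := hp
  obtain ⟨l, hl⟩ := hF ⟨p, hpF⟩
  have hpF' := hpF
  rw [hl] at hpF'
  obtain ⟨hpC, hpl⟩ := hpF'
  obtain ⟨hpσ, hp0⟩ := hull_sub u hpt hpC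
  have hp0 : p ≠ 0 := hp0
  obtain ⟨g, hg⟩ := dual_vec (-(l : (Fin 3 → ℝ) →ₗ[ℝ] ℝ))
  have hg : ∀ x, g ⬝ᵥ x = - l x := by intro x; rw [hg]; rfl
  have hmin : ∀ y ∈ hullC (coneOf u), g ⬝ᵥ p ≤ g ⬝ᵥ y := by
    intro y hy; rw [hg, hg]; linarith [hpl y hy]
  have hpos : ∀ x ∈ coneOf u, x ≠ 0 → 0 < g ⬝ᵥ x := by
    intro x hx hx0
    have h1 := hmin _ (hull_add u hu hpt p x hpC hx)
    rw [dotProduct_add] at h1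
    have h2 : 0 ≤ g ⬝ᵥ x := by linarith
    refine lt_of_le_of_ne h2 fun h0 => hx0 ?_
    obtain ⟨M, hM⟩ := isBounded_iff_forall_norm_le.1 hFc.isBounded
    by_contra hne
    have hxn : 0 < ‖x‖ := norm_pos_iff.2 hne
    obtain ⟨N, hN⟩ := exists_nat_gt ((M + ‖p‖) / ‖x‖)
    have hmem : p + (N:ℝ) • x ∈ F := by
      rw [hl]
      refine ⟨hull_add u hu hpt p _ hpC (cone_smul u hx (Nat.cast_nonneg N)), fun y hy => ?_⟩
      have h3 : l (p + (N:ℝ) • x) = l p := by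
        have h4 := hg x
        rw [← h0] at h4
        have h5 : l x = 0 := by linarith
        simp [h5]
      rw [h3]; exact hpl y hy
    have h6 := hM _ hmem
    have h7 : ‖(N:ℝ) • x‖ ≤ ‖p + (N:ℝ) • x‖ + ‖p‖ := by
      have := norm_sub_le (p + (N:ℝ) • x) p
      simpa using this
    rw [norm_smul, Real.norm_natCast] at h7
    rw [div_lt_iff₀ hxn] at hN
    linarith
  have hgp := hpos p hpσ hp0
  refine ⟨hpσ, hp0, (g ⬝ᵥ p)⁻¹ • g, ?_, fun y hy => ?_, fun x hx hx0 => ?_⟩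
  · rw [smul_dotProduct, smul_eq_mul, inv_mul_cancel₀ hgp.ne']
  · rw [smul_dotProduct, smul_eq_mul, inv_mul_eq_div, le_div_iff₀ hgp, one_mul]
    exact hmin y hy
  · rw [smul_dotProduct, smul_eq_mul]
    exact mul_pos (inv_pos.2 hgp) (hpos x hx hx0)

/-- The parallelepiped-type compact set. -/
def boxSet {e : ℕ} (u : Fin e → (Fin 3 → ℝ)) : Set (Fin 3 → ℝ) :=
  (fun c : Fin e → ℝ => ∑ i, c i • u i) '' Set.Icc 0 1

lemma box_bounded {e : ℕ} (u : Fin e → (Fin 3 → ℝ)) : Bornology.IsBounded (boxSet u) := by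
  have : IsCompact (Set.Icc (0 : Fin e → ℝ) 1) := isCompact_Icc
  exact (this.image (by fun_prop)).isBounded

lemma box_lat_finite {e : ℕ} (u : Fin e → (Fin 3 → ℝ)) : (boxSet u ∩ Lat3).Finite := by
  obtain ⟨M, hM⟩ := isBounded_iff_forall_norm_le.1 (box_bounded u)
  have hfin : ((fun m : Fin 3 → ℤ => fun j => (m j : ℝ)) ''
      (Set.Icc (fun _ => -⌈M⌉) (fun _ => ⌈M⌉))).Finite := (Set.finite_Icc _ _).image _
  refine hfin.subset ?_
  rintro x ⟨hx, hxl⟩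
  choose m hm using hxl
  have hb : ∀ j, |(m j : ℝ)| ≤ ⌈M⌉ := by
    intro j
    rw [← hm j, ← Real.norm_eq_abs]
    exact ((norm_le_pi_norm x j).trans (hM x hx)).trans (Int.le_ceil M)
  refine ⟨m, ⟨fun j => ?_, fun j => ?_⟩, ?_⟩
  · have := (abs_le.1 (hb j)).1; exact_mod_cast this
  · have := (abs_le.1 (hb j)).2; exact_mod_cast this
  · ext j; exact (hm j).symm

lemma box_or {e : ℕ} (u : Fin e → (Fin 3 → ℝ)) (x : Fin 3 → ℝ) (hx : x ∈ coneOf u) :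
    x ∈ boxSet u ∨ ∃ i, ∃ y ∈ coneOf u, x = u i + y := by
  obtain ⟨c, hc, rfl⟩ := hx
  by_cases h : ∀ i, c i ≤ 1
  · left; exact ⟨c, ⟨fun i => hc i, fun i => h i⟩, rfl⟩
  · right
    push Not at h
    obtain ⟨i, hi⟩ := h
    obtain ⟨y, hy, heq⟩ := cone_sub_gen u c hc i hi.le
    exact ⟨i, y, hy, heq⟩

lemma gen_mem_box {e : ℕ} (u : Fin e → (Fin 3 → ℝ)) (i : Fin e) : u i ∈ boxSet u := by
  classical
  refine ⟨Pi.single i 1, ⟨?_, ?_⟩, ?_⟩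
  · intro j
    by_cases h : j = i
    · subst h; simp
    · simp [h]
  · intro j
    by_cases h : j = i
    · subst h; simp
    · simp [h]
  · show ∑ j, (Pi.single i 1 : Fin e → ℝ) j • u j = u i
    rw [Finset.sum_eq_single i]
    · simp
    · intro j _ h; simp [h]
    · simp

lemma box_sub_cone {e : ℕ} (u : Fin e → (Fin 3 → ℝ)) : boxSet u ⊆ coneOf u := by
  rintro _ ⟨c, hc, rfl⟩
  exact ⟨c, fun i => hc.1 i, rfl⟩

lemma bd_lemma {e : ℕ} (u : Fin e → (Fin 3 → ℝ)) (x : Fin 3 → ℝ) (hx : x ∈ interior (coneOf u)) :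
    ∃ ρ : ℝ, 0 < ρ ∧ ∀ a : Fin 3 → ℝ, (∀ i, 0 ≤ a ⬝ᵥ u i) → ∀ j : Fin 3, ρ * |a j| ≤ a ⬝ᵥ x := by
  obtain ⟨r, hr, hball⟩ := Metric.isOpen_iff.1 isOpen_interior x hx
  refine ⟨r / 2, by positivity, fun a ha j => ?_⟩
  have hmem : ∀ t : ℝ, |t| < r → x + Pi.single j t ∈ coneOf u := by
    intro t ht
    apply interior_subset
    apply hball
    rw [Metric.mem_ball, dist_eq_norm, add_sub_cancel_left, Pi.norm_single, Real.norm_eq_abs]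
    exact ht
  have h1 := cone_nonneg u a ha (hmem (r / 2) (by rw [abs_of_pos] <;> linarith))
  have h2 := cone_nonneg u a ha (hmem (-(r / 2)) (by rw [abs_neg, abs_of_pos] <;> linarith))
  rw [dotProduct_add, dotProduct_single] at h1 h2
  rcases abs_cases (a j) with ⟨h, _⟩ | ⟨h, _⟩ <;> rw [h] <;> linarith

lemma exists_l (S : Finset (Fin 3 → ℝ)) (h : Fin 3 → ℝ) (hh : ∀ s ∈ S, 0 < h ⬝ᵥ s) :
    ∃ l : Fin 3 → ℝ, ∀ p ∈ S, ∀ q ∈ S, (∀ k : ℝ, q ≠ k • p) →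
      (h ⬝ᵥ p) * (l ⬝ᵥ q) - (l ⬝ᵥ p) * (h ⬝ᵥ q) ≠ 0 := by
  classical
  obtain ⟨f, hf⟩ := Module.exists_dual_forall_apply_ne_zero (K := ℝ)
    (fun x : S × S => if (h ⬝ᵥ x.1.1) • x.2.1 - (h ⬝ᵥ x.2.1) • x.1.1 = 0 then Pi.single 0 1
      else (h ⬝ᵥ x.1.1) • x.2.1 - (h ⬝ᵥ x.2.1) • x.1.1) (by
      intro x
      split_ifs with hx
      · simp
      · exact hx)
  obtain ⟨l, hl⟩ := dual_vec f
  refine ⟨l, fun p hp q hq hk => ?_⟩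
  have := hf (⟨p, hp⟩, ⟨q, hq⟩)
  have hne : ¬ (h ⬝ᵥ p) • q - (h ⬝ᵥ q) • p = 0 := by
    intro h0
    apply hk ((h ⬝ᵥ p)⁻¹ * (h ⬝ᵥ q))
    rw [mul_smul, ← sub_eq_zero.1 h0, smul_smul, inv_mul_cancel₀ (hh p hp).ne', one_smul]
  simp only [hne, if_false] at this
  rw [← hl, dotProduct_sub, dotProduct_smul, dotProduct_smul, smul_eq_mul, smul_eq_mul] at this
  intro h1
  apply this
  linarith

lemma exists_perp (m p : Fin 3 → ℝ) : ∃ d : Fin 3 → ℝ, m ⬝ᵥ d = 0 ∧ ∀ k : ℝ, d ≠ k • p := by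
  by_contra hcon
  push Not at hcon
  let φ : (Fin 3 → ℝ) →ₗ[ℝ] ℝ :=
    { toFun := fun x => m ⬝ᵥ x
      map_add' := fun x y => dotProduct_add _ _ _
      map_smul' := fun c x => by simp [dotProduct_smul] }
  have hle : LinearMap.ker φ ≤ Submodule.span ℝ {p} := by
    intro x hx
    obtain ⟨k, hk⟩ := hcon x hx
    rw [hk]
    exact Submodule.smul_mem _ _ (Submodule.mem_span_singleton_self p)
  have h1 := LinearMap.finrank_range_add_finrank_ker φ
  have h2 := Submodule.finrank_mono hle
  have h3 : Module.finrank ℝ (Submodule.span ℝ {p}) ≤ 1 := by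
    have := finrank_span_le_card (R := ℝ) ({p} : Set (Fin 3 → ℝ))
    simpa using this
  have h4 : Module.finrank ℝ (LinearMap.range φ) ≤ 1 := by
    have := Submodule.finrank_le (LinearMap.range φ)
    simpa using this
  rw [Module.finrank_fin_fun] at h1
  omega

lemma three_le {e : ℕ} (u : Fin e → (Fin 3 → ℝ)) (hfull : (interior (coneOf u)).Nonempty) :
    3 ≤ e := by
  have hsub : coneOf u ⊆ (Submodule.span ℝ (Set.range u) : Set (Fin 3 → ℝ)) := by
    rintro _ ⟨c, _, rfl⟩
    exact Submodule.sum_mem _ fun i _ =>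
      Submodule.smul_mem _ _ (Submodule.subset_span (Set.mem_range_self i))
  have htop := Submodule.eq_top_of_nonempty_interior' _ (hfull.mono (interior_mono hsub))
  have h1 := finrank_range_le_card (R := ℝ) u
  rw [Set.finrank, htop, finrank_top, Module.finrank_fin_fun, Fintype.card_fin] at h1
  exact h1

lemma main_bound {e : ℕ} (u : Fin e → (Fin 3 → ℝ)) (hu : ∀ i, u i ∈ Lat3) (hu0 : ∀ i, u i ≠ 0)
    (hpt : ∀ x ∈ coneOf u, -x ∈ coneOf u → x = 0) (hfull : (interior (coneOf u)).Nonempty) :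
    2 * ((compactFacesUnion (coneOf u) ∩ Lat3 ∩ interior (coneOf u)).ncard : ℝ) +
      ((compactFacesUnion (coneOf u) ∩ Lat3 ∩ frontier (coneOf u)).ncard : ℝ) ≤
      6 * (volume (coneOf u \ hullC (coneOf u))).toReal + 2 := by
  classical
  have hfinS : ((boxSet u ∩ Lat3) \ {0}).Finite := (box_lat_finite u).sdiff
  set S := hfinS.toFinset with hSdef
  have hSmem : ∀ x, x ∈ S ↔ (x ∈ boxSet u ∧ x ∈ Lat3) ∧ x ≠ 0 := by
    intro x; simp [hSdef]
  have huS : ∀ i, u i ∈ S := fun i => (hSmem _).2 ⟨⟨gen_mem_box u i, hu i⟩, hu0 i⟩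
  have hScone : ∀ s ∈ S, s ∈ coneOf u := fun s hs => box_sub_cone u ((hSmem s).1 hs).1.1
  have hShull : ∀ s ∈ S, s ∈ hullC (coneOf u) := fun s hs =>
    subset_convexHull ℝ _ ⟨⟨hScone s hs, ((hSmem s).1 hs).2⟩, ((hSmem s).1 hs).1.2⟩
  have hKS : ∀ p ∈ compactFacesUnion (coneOf u) ∩ Lat3, p ∈ S := by
    rintro p ⟨hp, hpl⟩
    obtain ⟨hpσ, hp0, f, hfp, hf1, hfpos⟩ := K_point u hu hpt p hp
    rcases box_or u p hpσ with h | ⟨i, y, hy, hpy⟩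
    · exact (hSmem p).2 ⟨⟨h, hpl⟩, hp0⟩
    · by_cases hy0 : y = 0
      · rw [hpy, hy0, add_zero]; exact huS i
      · exfalso
        have h1 := hfpos y hy hy0
        have h2 := hf1 _ (hShull _ (huS i))
        rw [hpy, dotProduct_add] at hfp
        linarith
  have hfinK : (compactFacesUnion (coneOf u) ∩ Lat3).Finite :=
    S.finite_toSet.subset hKS
  -- finite volume
  have hvol : volume (coneOf u \ hullC (coneOf u)) ≠ ⊤ := by
    have hsub : coneOf u \ hullC (coneOf u) ⊆ boxSet u := by
      rintro x ⟨hx, hxC⟩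
      rcases box_or u x hx with h | ⟨i, y, hy, hxy⟩
      · exact h
      · exfalso
        apply hxC
        rw [hxy]
        exact hull_add u hu hpt _ _ (hShull _ (huS i)) hy
    exact ((box_bounded u).subset hsub).measure_lt_top.ne
  by_cases hKne : (compactFacesUnion (coneOf u) ∩ Lat3).Nonempty
  swap
  · rw [Set.not_nonempty_iff_eq_empty] at hKne
    rw [hKne]
    simp only [Set.empty_inter, Set.ncard_empty]
    have : 0 ≤ (volume (coneOf u \ hullC (coneOf u))).toReal := ENNReal.toReal_nonneg
    push_cast
    linarith
  obtain ⟨p0, hp0K, _⟩ := hKne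
  obtain ⟨_, _, h, _, _, hpos⟩ := K_point u hu hpt p0 hp0K
  have hh : ∀ s ∈ S, 0 < h ⬝ᵥ s := fun s hs => hpos s (hScone s hs) ((hSmem s).1 hs).2
  obtain ⟨l, hl⟩ := exists_l S h hh
  set P := hfinK.toFinset with hPdef
  have hPmem : ∀ x, x ∈ P ↔ x ∈ compactFacesUnion (coneOf u) ∩ Lat3 := by
    intro x; simp [hPdef]
  have hPS : ∀ p ∈ P, p ∈ S := fun p hp => hKS p ((hPmem p).1 hp)
  have hPf : ∀ p ∈ P, ∃ f : Fin 3 → ℝ, f ⬝ᵥ p = 1 ∧ ∀ s ∈ S, 1 ≤ f ⬝ᵥ s := by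
    intro p hp
    obtain ⟨_, _, f, hfp, hf1, _⟩ := K_point u hu hpt p ((hPmem p).1 hp).1
    exact ⟨f, hfp, fun s hs => hf1 s (hShull s hs)⟩
  have hpar : ∀ p ∈ P, ∀ p' ∈ P, ∀ k : ℝ, p' = k • p → p = p' := by
    intro p hp p' hp' k hk
    obtain ⟨f, hf, hf1⟩ := hPf p hp
    obtain ⟨f', hf', hf1'⟩ := hPf p' hp'
    have h1 := hf1 p' (hPS p' hp')
    have h2 := hf1' p (hPS p hp)
    rw [hk, dotProduct_smul, hf, smul_eq_mul, mul_one] at h1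
    rw [hk, dotProduct_smul, smul_eq_mul] at hf'
    have : k = 1 := by nlinarith
    rw [hk, this, one_smul]
  obtain ⟨w, hw0, gen, hfeas, hlim⟩ := exists_w S P hPf
  let m : (Fin 3 → ℝ) → (Fin 3 → ℝ) → ℝ := fun p x => (h ⬝ᵥ p) * (l ⬝ᵥ x) - (l ⬝ᵥ p) * (h ⬝ᵥ x)
  let Pi := P.filter (fun p => p ∈ interior (coneOf u))
  let Pb := P.filter (fun p => p ∈ frontier (coneOf u))
  let E1 := Pb.filter (fun p => ∀ x ∈ coneOf u, 0 ≤ m p x)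
  let E2 := Pb.filter (fun p => ∀ x ∈ coneOf u, m p x ≤ 0)
  have hm0 : ∀ p ∈ P, ∀ p' ∈ P, m p p' = 0 → p = p' := by
    intro p hp p' hp' h0
    by_contra hne
    apply hl p (hPS p hp) p' (hPS p' hp') _ h0
    intro k hk
    exact hne (hpar p hp p' hp' k hk)
  have hanti : ∀ p p', m p p' = - m p' p := by intro p p'; simp only [m]; ring
  have hE1 : E1.card ≤ 1 := by
    rw [Finset.card_le_one]
    intro p hp p' hp'
    simp only [E1, Pb, Finset.mem_filter] at hp hp'
    apply hm0 p hp.1.1 p' hp'.1.1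
    have a1 := hp.2 p' (hScone _ (hPS _ hp'.1.1))
    have a2 := hp'.2 p (hScone _ (hPS _ hp.1.1))
    have a3 := hanti p p'
    linarith
  have hE2 : E2.card ≤ 1 := by
    rw [Finset.card_le_one]
    intro p hp p' hp'
    simp only [E2, Pb, Finset.mem_filter] at hp hp'
    apply hm0 p hp.1.1 p' hp'.1.1
    have a1 := hp.2 p' (hScone _ (hPS _ hp'.1.1))
    have a2 := hp'.2 p (hScone _ (hPS _ hp.1.1))
    have a3 := hanti p p'
    linarith
  let Pc := Pb \ (E1 ∪ E2)
  have hdir : ∀ p, ∃ d : Fin 3 → ℝ, (p ∈ Pi → m p d = 0 ∧ ∀ k : ℝ, d ≠ k • p) ∧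
      (p ∈ Pc → m p d = 0 ∧ (∀ k : ℝ, d ≠ k • p) ∧ d ∈ interior (coneOf u)) := by
    intro p
    by_cases hpi : p ∈ interior (coneOf u)
    · obtain ⟨d, hd, hk⟩ := exists_perp ((h ⬝ᵥ p) • l - (l ⬝ᵥ p) • h) p
      rw [sub_dotProduct, smul_dotProduct, smul_dotProduct, smul_eq_mul, smul_eq_mul] at hd
      refine ⟨d, fun _ => ⟨hd, hk⟩, fun hpc => ?_⟩
      exfalso
      simp only [Pc, Pb, Finset.mem_sdiff, Finset.mem_filter] at hpc
      exact hpc.1.2.2 hpi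
    · by_cases hpc : p ∈ Pc
      swap
      · refine ⟨0, fun hp => ?_, fun hp => absurd hp hpc⟩
        simp only [Pi, Finset.mem_filter] at hp
        exact absurd hp.2 hpi
      have hpP : p ∈ P := by
        simp only [Pc, Pb, Finset.mem_sdiff, Finset.mem_filter] at hpc
        exact hpc.1.1
      have hpb : p ∈ Pb := (Finset.mem_sdiff.1 hpc).1
      have hnE := (Finset.mem_sdiff.1 hpc).2
      have hx1 : ∃ x ∈ coneOf u, m p x < 0 := by
        by_contra hcon
        push Not at hcon
        exact hnE (Finset.mem_union_left _ (Finset.mem_filter.2 ⟨hpb, hcon⟩))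
      have hx2 : ∃ x ∈ coneOf u, 0 < m p x := by
        by_contra hcon
        push Not at hcon
        exact hnE (Finset.mem_union_right _ (Finset.mem_filter.2 ⟨hpb, hcon⟩))
      obtain ⟨x1, hx1, hm1⟩ := hx1
      obtain ⟨x2, hx2, hm2⟩ := hx2
      obtain ⟨y, hy⟩ := hfull
      have hlin : ∀ s t : ℝ, ∀ a b, m p (s • a + t • b) = s * m p a + t * m p b := by
        intro s t a b
        simp only [m, dotProduct_add, dotProduct_smul, smul_eq_mul]
        ring
      have hz : ∃ z ∈ interior (coneOf u), m p z = 0 := by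
        rcases lt_trichotomy (m p y) 0 with hmy | hmy | hmy
        · refine ⟨(-(m p y)) • x2 + (m p x2) • y,
            cone_interior u hx2 hy (by linarith) hm2, ?_⟩
          rw [hlin]; ring
        · exact ⟨y, hy, hmy⟩
        · refine ⟨(m p y) • x1 + (-(m p x1)) • y,
            cone_interior u hx1 hy hmy.le (by linarith), ?_⟩
          rw [hlin]; ring
      obtain ⟨z, hz, hmz⟩ := hz
      refine ⟨z, fun hp => ?_, fun _ => ⟨hmz, ?_, hz⟩⟩
      · simp only [Pi, Finset.mem_filter] at hp
        exact absurd hp.2 hpi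
      · intro k hk
        apply hpi
        have hpS := hPS p hpP
        have hhp := hh p hpS
        have hpσ := hScone p hpS
        rcases le_or_gt k 0 with hk0 | hk0
        · have h1 := cone_interior u (cone_smul u hpσ (t := -k) (by linarith)) hz
            zero_le_one one_pos
          have h2 : (1:ℝ) • (-k) • p + (1:ℝ) • z = 0 := by rw [hk]; module
          rw [h2] at h1
          have h3 := cone_interior u hpσ h1 zero_le_one one_pos
          simpa using h3
        · have h1 := cone_interior u hpσ hz le_rfl (inv_pos.2 hk0)
          rw [hk, smul_smul, inv_mul_cancel₀ hk0.ne'] at h1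
          simpa using h1
  choose D hD1 hD2 using hdir
  let J : Finset ((Fin 3 → ℝ) × Bool) := Pi ×ˢ Finset.univ ∪ Pc ×ˢ {true}
  have hPiP : ∀ p ∈ Pi, p ∈ P := fun p hp => (Finset.mem_filter.1 hp).1
  have hPcP : ∀ p ∈ Pc, p ∈ P := fun p hp =>
    (Finset.mem_filter.1 (Finset.mem_sdiff.1 hp).1).1
  have hbdd : ∀ p d, p + d ∈ interior (coneOf u) → ∃ ρ : ℝ, 0 < ρ ∧ ∀ a : Fin 3 → ℝ,
      (∀ s ∈ S, w s ≤ a ⬝ᵥ s) → ∀ i : Fin 3, ρ * |a i| ≤ a ⬝ᵥ (p + d) := by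
    intro p d hpd
    obtain ⟨ρ, hρ, hb⟩ := bd_lemma u _ hpd
    exact ⟨ρ, hρ, fun a ha => hb a fun i => (hw0 _ (huS i)).le.trans (ha _ (huS i))⟩
  have hopen : ∀ p ∈ interior (coneOf u), ∀ d : Fin 3 → ℝ, ∃ δ : ℝ, 0 < δ ∧
      p + δ • d ∈ interior (coneOf u) := by
    intro p hp d
    have hc : Continuous fun t : ℝ => p + t • d := by fun_prop
    have hev : ∀ᶠ t : ℝ in nhds 0, p + t • d ∈ interior (coneOf u) := by
      apply hc.continuousAt.eventually (p := fun y => y ∈ interior (coneOf u))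
      apply isOpen_interior.mem_nhds
      simpa using hp
    obtain ⟨t, ht, ht0⟩ := ((hev.filter_mono nhdsWithin_le_nhds).and
      (self_mem_nhdsWithin (s := Set.Ioi (0:ℝ)))).exists
    exact ⟨t, ht0, ht⟩
  have hJ : ∀ j ∈ J, j.1 ∈ S ∧
      (∃ a : Fin 3 → ℝ, a ⬝ᵥ j.1 = w j.1 ∧ ∀ s ∈ S, w s ≤ a ⬝ᵥ s) ∧
      (∃ δ : ℝ, 0 < δ ∧ ∃ ρ : ℝ, 0 < ρ ∧ ∀ a : Fin 3 → ℝ, (∀ s ∈ S, w s ≤ a ⬝ᵥ s) →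
        ∀ i : Fin 3, ρ * |a i| ≤ a ⬝ᵥ (j.1 + δ • (if j.2 then D j.1 else -D j.1))) ∧
      (h ⬝ᵥ j.1) * (l ⬝ᵥ D j.1) - (l ⬝ᵥ j.1) * (h ⬝ᵥ D j.1) = 0 ∧
        (∀ k : ℝ, D j.1 ≠ k • j.1) := by
    rintro ⟨p, s⟩ hj
    rcases Finset.mem_union.1 hj with hj | hj
    · have hp : p ∈ Pi := (Finset.mem_product.1 hj).1
      refine ⟨hPS p (hPiP p hp), hfeas p (hPiP p hp), ?_, (hD1 p hp).1, (hD1 p hp).2⟩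
      obtain ⟨δ, hδ, hin⟩ := hopen p (Finset.mem_filter.1 hp).2 (if s then D p else -D p)
      exact ⟨δ, hδ, hbdd _ _ hin⟩
    · have hp : p ∈ Pc := (Finset.mem_product.1 hj).1
      have hs : s = true := Finset.mem_singleton.1 (Finset.mem_product.1 hj).2
      subst hs
      refine ⟨hPS p (hPcP p hp), hfeas p (hPcP p hp), ?_, (hD2 p hp).1, (hD2 p hp).2.1⟩
      refine ⟨1, one_pos, hbdd _ _ ?_⟩
      have := cone_interior u (hScone _ (hPS p (hPcP p hp))) (hD2 p hp).2.2 zero_le_one one_pos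
      simpa using this
  have hR : ∀ B : Fin 3 → (Fin 3 → ℝ), (∀ i, B i ∈ S) →
      (∃ b : Fin 3 → ℝ, (∀ i, b ⬝ᵥ B i = 1) ∧ ∀ s ∈ S, 1 ≤ b ⬝ᵥ s) →
      osimp B ⊆ coneOf u \ hullC (coneOf u) := by
    rintro B hB ⟨b, hb, hb1⟩ x ⟨c, ⟨hc, hc1⟩, rfl⟩
    constructor
    · rw [Fin.sum_univ_three]
      exact cone_add u (cone_add u (cone_smul u (hScone _ (hB 0)) (hc 0).le)
        (cone_smul u (hScone _ (hB 1)) (hc 1).le)) (cone_smul u (hScone _ (hB 2)) (hc 2).le)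
    · intro hx
      have hsub : hullC (coneOf u) ⊆ {x | 1 ≤ b ⬝ᵥ x} := by
        refine convexHull_min ?_ ?_
        · rintro x ⟨⟨hx, hx0⟩, hxl⟩
          rcases box_or u x hx with h1 | ⟨i, y, hy, hxy⟩
          · exact hb1 x ((hSmem x).2 ⟨⟨h1, hxl⟩, hx0⟩)
          · have h1 := hb1 _ (huS i)
            have h2 := cone_nonneg u b (fun i => zero_le_one.trans (hb1 _ (huS i))) hy
            show 1 ≤ b ⬝ᵥ x
            rw [hxy, dotProduct_add]
            linarith
        · intro x hx y hy s t hs ht hst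
          have hx : 1 ≤ b ⬝ᵥ x := hx
          have hy : 1 ≤ b ⬝ᵥ y := hy
          show 1 ≤ b ⬝ᵥ (s • x + t • y)
          rw [dotProduct_add, dotProduct_smul, dotProduct_smul, smul_eq_mul, smul_eq_mul]
          nlinarith
      have h1 : 1 ≤ b ⬝ᵥ (∑ i, c i • B i) := hsub hx
      rw [dotProduct_sum, Fin.sum_univ_three] at h1
      simp only [dotProduct_smul, hb, smul_eq_mul, mul_one] at h1
      linarith
  have hbound := vol_bound S w h l (coneOf u \ hullC (coneOf u)) J D
    (fun s hs => ((hSmem s).1 hs).1.2) gen hlim hh hl hR hJ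
  have hreal : (J.card : ℝ) * (1 / 6) ≤ (volume (coneOf u \ hullC (coneOf u))).toReal := by
    have := ENNReal.toReal_mono hvol hbound
    rwa [ENNReal.toReal_mul, ENNReal.toReal_natCast, ENNReal.toReal_ofReal (by norm_num)] at this
  have hJcard : J.card = 2 * Pi.card + Pc.card := by
    rw [Finset.card_union_of_disjoint]
    · rw [Finset.card_product, Finset.card_product]
      simp [mul_comm]
    · rw [Finset.disjoint_left]
      rintro ⟨p, s⟩ h1 h2
      have hp1 := (Finset.mem_filter.1 (Finset.mem_product.1 h1).1).2
      have hp2 := (Finset.mem_filter.1 (Finset.mem_sdiff.1 (Finset.mem_product.1 h2).1).1).2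
      exact hp2.2 hp1
  have hPc : Pb.card ≤ Pc.card + 2 := by
    have h1 := Finset.le_card_sdiff (E1 ∪ E2) Pb
    have h2 := Finset.card_union_le E1 E2
    have h3 : Pc.card = (Pb \ (E1 ∪ E2)).card := rfl
    omega
  have hPi : (compactFacesUnion (coneOf u) ∩ Lat3 ∩ interior (coneOf u)).ncard = Pi.card := by
    rw [← Set.ncard_coe_finset]
    congr 1
    ext x
    simp [Pi, hPdef]
    tauto
  have hPb : (compactFacesUnion (coneOf u) ∩ Lat3 ∩ frontier (coneOf u)).ncard = Pb.card := by
    rw [← Set.ncard_coe_finset]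
    congr 1
    ext x
    simp [Pb, hPdef]
    tauto
  rw [hPi, hPb]
  have h1 : (J.card : ℝ) = 2 * Pi.card + Pc.card := by exact_mod_cast hJcard
  have h2 : (Pb.card : ℝ) ≤ Pc.card + 2 := by exact_mod_cast hPc
  linarith

/-- let `σ ⊆ ℝ³` be a 3-dimensional pointed rational polyhedral cone with
`e` extreme rays, `C = conv((σ ∖ {0}) ∩ ℤ³)`, `K` the union of the compact faces of
`C`, and `b` (resp. `i`) the number of lattice points of `K` on the boundary (resp. in
the interior) of `σ`.  Then `6·λ(σ ∖ C) + e − b ≥ 2i + 1 ≥ 1`; the left-hand side is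
the local Euler obstruction of the torus-fixed point of `U_σ` when that point is an
isolated singularity, so local Euler obstructions at isolated singular points of toric
3-folds are `≥ 1`. -/
theorem euler_obstruction_isolated_threefold (e : ℕ) (u : Fin e → (Fin 3 → ℝ))
    (hu : ∀ i, u i ∈ Lat3)
    (σ : Set (Fin 3 → ℝ))
    (hσ : σ = {x | ∃ c : Fin e → ℝ, (∀ i, 0 ≤ c i) ∧ x = ∑ i, c i • u i})
    (hpointed : ∀ x ∈ σ, -x ∈ σ → x = 0)
    (hfull : (interior σ).Nonempty)
    (hextreme : ∀ i, u i ∉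
      {x | ∃ c : Fin e → ℝ, (∀ j, 0 ≤ c j) ∧ c i = 0 ∧ x = ∑ j, c j • u j}) :
    6 * (volume (σ \ hullC σ)).toReal + (e : ℝ)
        - ((compactFacesUnion σ ∩ Lat3 ∩ frontier σ).ncard : ℝ)
      ≥ 2 * ((compactFacesUnion σ ∩ Lat3 ∩ interior σ).ncard : ℝ) + 1 ∧
    2 * ((compactFacesUnion σ ∩ Lat3 ∩ interior σ).ncard : ℝ) + 1 ≥ 1 := by
  have hσ' : σ = coneOf u := hσ
  clear hσ
  subst hσ'
  have hu0 : ∀ i, u i ≠ 0 := by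
    intro i h0
    exact hextreme i ⟨fun _ => 0, fun _ => le_rfl, rfl, by simp [h0]⟩
  have h1 := main_bound u hu hu0 hpointed hfull
  have h2 : (3:ℝ) ≤ e := by exact_mod_cast three_le u hfull
  constructor
  · linarith
  · have : (0:ℝ) ≤ ((compactFacesUnion (coneOf u) ∩ Lat3 ∩ interior (coneOf u)).ncard : ℝ) :=
      Nat.cast_nonneg _
    linarith
end

section
/- Let P ⊆ ℝ² be a 2-dimensional lattice triangle with i interior lattice points and b boundary lattice points. For each vertex v of P let σ_v = Cone(P − v) be the cone of P at v. Then Σ_{v vertex of P} RSV(σ_v) ≤ 3i + b. -/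
open MeasureTheory

/-- The standard lattice `ℤ²` inside `ℝ²`. -/
def Lat2 : Set (Fin 2 → ℝ) := {x | ∀ j, ∃ m : ℤ, x j = (m : ℝ)}

/-- `{e₁, e₂}` is a ℤ-basis of the lattice `ℤ² ⊆ ℝ²`, i.e. the two vectors are lattice
vectors generating `ℤ²` as a ℤ-module. -/
def IsZBasis (e₁ e₂ : Fin 2 → ℝ) : Prop :=
  e₁ ∈ Lat2 ∧ e₂ ∈ Lat2 ∧ ∀ x ∈ Lat2, ∃ a b : ℤ, x = a • e₁ + b • e₂

/-- `u` is a primitive lattice vector: its (integer) coordinates have gcd `1`. -/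
def IsPrimitive (u : Fin 2 → ℝ) : Prop :=
  ∃ a b : ℤ, u 0 = (a : ℝ) ∧ u 1 = (b : ℝ) ∧ Int.gcd a b = 1

/-- The cone spanned by two vectors: `Cone(u,v) = ℝ≥0·u + ℝ≥0·v`. -/
def coneTwo (u v : Fin 2 → ℝ) : Set (Fin 2 → ℝ) :=
  {x | ∃ a b : ℝ, 0 ≤ a ∧ 0 ≤ b ∧ x = a • u + b • v}

/-- Matsui–Takeuchi's normalized relative subdiagram volume of a plane cone `σ` at its
apex: twice the Lebesgue measure of `σ ∖ conv((σ ∖ {0}) ∩ ℤ²)`. -/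
noncomputable def RSV (σ : Set (Fin 2 → ℝ)) : ℝ :=
  2 * (volume (σ \ convexHull ℝ ((σ \ {0}) ∩ Lat2))).toReal

/-- The cone of a polytope `P` at a point `v`: all nonnegative combinations of `P − v`
(for convex `P` this is `{t·(p − v) : t ≥ 0, p ∈ P}`). -/
def coneAt (P : Set (Fin 2 → ℝ)) (v : Fin 2 → ℝ) : Set (Fin 2 → ℝ) :=
  {x | ∃ t : ℝ, 0 ≤ t ∧ ∃ p ∈ P, x = t • (p - v)}


def dt (a b : Fin 2 → ℝ) : ℝ := a 0 * b 1 - a 1 * b 0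

def subd (a b : Fin 2 → ℝ) : Set (Fin 2 → ℝ) :=
  coneTwo a b \ convexHull ℝ ((coneTwo a b \ {0}) ∩ Lat2)

def triPts (a b : Fin 2 → ℝ) : Set (Fin 2 → ℝ) :=
  {x | x ∈ Lat2 ∧ ∃ s t : ℝ, 0 < s ∧ 0 < t ∧ s + t ≤ 1 ∧ x = s • a + t • b}

lemma lat_add_s17 {a b : Fin 2 → ℝ} (ha : a ∈ Lat2) (hb : b ∈ Lat2) : a + b ∈ Lat2 := by
  intro j
  obtain ⟨m, hm⟩ := ha j
  obtain ⟨n, hn⟩ := hb j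
  exact ⟨m + n, by simp [hm, hn]⟩

lemma lat_smul {a : Fin 2 → ℝ} (ha : a ∈ Lat2) (z : ℤ) : (z : ℝ) • a ∈ Lat2 := by
  intro j
  obtain ⟨m, hm⟩ := ha j
  exact ⟨z * m, by simp [hm]⟩

lemma lat_sub {a b : Fin 2 → ℝ} (ha : a ∈ Lat2) (hb : b ∈ Lat2) : a - b ∈ Lat2 := by
  intro j
  obtain ⟨m, hm⟩ := ha j
  obtain ⟨n, hn⟩ := hb j
  exact ⟨m - n, by simp [hm, hn]⟩

lemma lat_finite (M : ℝ) : ({x | ∀ j, |x j| ≤ M} ∩ Lat2 : Set (Fin 2 → ℝ)).Finite := by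
  refine ((Set.finite_Icc (fun _ : Fin 2 => -⌈M⌉) (fun _ => ⌈M⌉)).image
    (fun (z : Fin 2 → ℤ) j => (z j : ℝ))).subset ?_
  rintro x ⟨hx, hl⟩
  choose z hz using hl
  refine ⟨z, ⟨fun j => ?_, fun j => ?_⟩, ?_⟩
  · have h := hx j
    rw [hz j, abs_le] at h
    have h2 := Int.le_ceil M
    have : ((-⌈M⌉ : ℤ) : ℝ) ≤ z j := by push_cast; linarith
    exact_mod_cast this
  · have h := hx j
    rw [hz j, abs_le] at h
    have h2 := Int.le_ceil M
    have : (z j : ℝ) ≤ (⌈M⌉ : ℤ) := by linarith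
    exact_mod_cast this
  · ext j; simp [hz j]

lemma lat_finite_of_bounded {S : Set (Fin 2 → ℝ)} (hS : Bornology.IsBounded S) :
    (S ∩ Lat2).Finite := by
  obtain ⟨M, hM⟩ := hS.exists_norm_le
  refine (lat_finite M).subset ?_
  rintro x ⟨hx, hl⟩
  refine ⟨fun j => ?_, hl⟩
  have := norm_le_pi_norm x j
  rw [Real.norm_eq_abs] at this
  exact this.trans (hM x hx)

lemma triPts_finite (a b : Fin 2 → ℝ) : (triPts a b).Finite := by
  have hb : Bornology.IsBounded (convexHull ℝ ({0, a, b} : Set (Fin 2 → ℝ))) := by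
    rw [isBounded_convexHull]
    exact (Set.toFinite _).isBounded
  refine (lat_finite_of_bounded hb).subset ?_
  rintro x ⟨hx, s, t, hs, ht, hst, rfl⟩
  refine ⟨?_, hx⟩
  have h0 : (0 : Fin 2 → ℝ) ∈ convexHull ℝ ({0, a, b} : Set (Fin 2 → ℝ)) :=
    subset_convexHull _ _ (by simp)
  have h1 : a ∈ convexHull ℝ ({0, a, b} : Set (Fin 2 → ℝ)) :=
    subset_convexHull _ _ (by simp)
  have h2 : b ∈ convexHull ℝ ({0, a, b} : Set (Fin 2 → ℝ)) :=
    subset_convexHull _ _ (by simp)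
  have hc := convex_convexHull ℝ ({0, a, b} : Set (Fin 2 → ℝ))
  have h3 := hc h1 h2 (a := s / (s + t)) (b := t / (s + t)) (by positivity) (by positivity)
    (by field_simp)
  have h4 := hc h0 h3 (a := 1 - (s + t)) (b := s + t) (by linarith) (by positivity) (by ring)
  convert h4 using 1
  ext j
  simp
  field_simp

lemma dt_int {a b : Fin 2 → ℝ} (ha : a ∈ Lat2) (hb : b ∈ Lat2) : ∃ z : ℤ, dt a b = z := by
  obtain ⟨p, hp⟩ := ha 0
  obtain ⟨q, hq⟩ := ha 1
  obtain ⟨r, hr⟩ := hb 0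
  obtain ⟨w, hw⟩ := hb 1
  exact ⟨p * w - q * r, by simp [dt, hp, hq, hr, hw]⟩

lemma decomp {a b : Fin 2 → ℝ} (h : dt a b ≠ 0) (x : Fin 2 → ℝ) :
    x = (dt x b / dt a b) • a + (dt a x / dt a b) • b := by
  ext j
  simp only [Pi.add_apply, Pi.smul_apply, smul_eq_mul]
  rw [div_mul_eq_mul_div, div_mul_eq_mul_div, ← add_div, eq_div_iff h]
  unfold dt
  fin_cases j <;> simp <;> ring

lemma decomp_unique {a b : Fin 2 → ℝ} (h : dt a b ≠ 0) {s t s' t' : ℝ}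
    (e : s • a + t • b = s' • a + t' • b) : s = s' ∧ t = t' := by
  have e0 := congrFun e 0
  have e1 := congrFun e 1
  simp at e0 e1
  unfold dt at h
  constructor
  · apply mul_right_cancel₀ h
    linear_combination b 1 * e0 - b 0 * e1
  · apply mul_right_cancel₀ h
    linear_combination a 0 * e1 - a 1 * e0

lemma vol_std : 2 * volume {x : Fin 2 → ℝ | 0 ≤ x 0 ∧ 0 ≤ x 1 ∧ x 0 + x 1 < 1} ≤ 1 := by
  set T : Set (Fin 2 → ℝ) := {x | 0 ≤ x 0 ∧ 0 ≤ x 1 ∧ x 0 + x 1 < 1} with hT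
  set c : Fin 2 → ℝ := fun _ => 1
  have hTm : MeasurableSet T := by
    apply MeasurableSet.inter
    · exact measurableSet_le measurable_const (measurable_pi_apply 0)
    apply MeasurableSet.inter
    · exact measurableSet_le measurable_const (measurable_pi_apply 1)
    · exact measurableSet_lt ((measurable_pi_apply 0).add (measurable_pi_apply 1))
        measurable_const
  have hpre : volume ((fun x => c - x) ⁻¹' T) = volume T :=
    (Measure.measurePreserving_sub_left volume c).measure_preimage hTm.nullMeasurableSet
  have hd : Disjoint ((fun x => c - x) ⁻¹' T) T := by
    rw [Set.disjoint_left]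
    rintro x ⟨h1, h2, h3⟩ ⟨h4, h5, h6⟩
    simp [c] at h1 h2 h3
    linarith
  have hU := measure_union (μ := volume) hd hTm
  rw [hpre] at hU
  rw [two_mul, ← hU]
  calc volume ((fun x => c - x) ⁻¹' T ∪ T) ≤ volume (Set.Icc (0 : Fin 2 → ℝ) c) := by
        apply measure_mono
        rintro x (⟨h1, h2, h3⟩ | ⟨h4, h5, h6⟩)
        · simp [c] at h1 h2 h3
          constructor <;> intro j <;> fin_cases j <;> simp [c] <;> linarith
        · constructor <;> intro j <;> fin_cases j <;> simp [c] <;> linarith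
    _ = 1 := by
        rw [Real.volume_Icc_pi]
        simp [c]

lemma vol_tri {a b : Fin 2 → ℝ} (h : |dt a b| = 1) :
    2 * volume {x : Fin 2 → ℝ | ∃ s t : ℝ, 0 ≤ s ∧ 0 ≤ t ∧ s + t < 1 ∧ x = s • a + t • b} ≤ 1 := by
  have key : {x : Fin 2 → ℝ | ∃ s t : ℝ, 0 ≤ s ∧ 0 ≤ t ∧ s + t < 1 ∧ x = s • a + t • b} =
      (Matrix.toLin' !![a 0, b 0; a 1, b 1]) ''
        {x : Fin 2 → ℝ | 0 ≤ x 0 ∧ 0 ≤ x 1 ∧ x 0 + x 1 < 1} := by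
    ext x
    constructor
    · rintro ⟨s, t, hs, ht, hst, rfl⟩
      refine ⟨![s, t], by simpa using ⟨hs, ht, hst⟩, ?_⟩
      ext j
      fin_cases j <;> simp [Matrix.mulVec, dotProduct, Fin.sum_univ_two] <;> ring
    · rintro ⟨y, ⟨h1, h2, h3⟩, rfl⟩
      refine ⟨y 0, y 1, h1, h2, h3, ?_⟩
      ext j
      fin_cases j <;> simp [Matrix.mulVec, dotProduct, Fin.sum_univ_two] <;> ring
  rw [key, Measure.addHaar_image_linearMap, LinearMap.det_toLin', Matrix.det_fin_two_of]
  have : a 0 * b 1 - b 0 * a 1 = dt a b := by unfold dt; ring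
  rw [this, h]
  simpa using vol_std

lemma hull_mem {a b : Fin 2 → ℝ} (ha : a ∈ Lat2) (hb : b ∈ Lat2) (h : dt a b ≠ 0)
    {p q : ℝ} (hp : 0 ≤ p) (hq : 0 ≤ q) (hpq : 1 ≤ p + q) :
    p • a + q • b ∈ convexHull ℝ ((coneTwo a b \ {0}) ∩ Lat2) := by
  have ha0 : a ≠ 0 := by rintro rfl; simp [dt] at h
  have hb0 : b ≠ 0 := by rintro rfl; simp [dt] at h
  set r := p + q with hr
  obtain ⟨n, hn⟩ : ∃ n : ℕ, r + 1 ≤ n := exists_nat_ge _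
  have hn0 : (n : ℝ) ≠ 0 := by intro h; linarith
  have hc := convex_convexHull ℝ ((coneTwo a b \ {0}) ∩ Lat2)
  have m1 : ∀ k : ℕ, (k : ℝ) ≠ 0 → (k : ℝ) • a ∈ convexHull ℝ ((coneTwo a b \ {0}) ∩ Lat2) := by
    intro k hk
    apply subset_convexHull
    refine ⟨⟨⟨k, 0, by positivity, le_rfl, by simp⟩, ?_⟩, by exact_mod_cast lat_smul ha k⟩
    simp only [Set.mem_singleton_iff, smul_eq_zero, not_or]
    exact ⟨hk, ha0⟩
  have m2 : ∀ k : ℕ, (k : ℝ) ≠ 0 → (k : ℝ) • b ∈ convexHull ℝ ((coneTwo a b \ {0}) ∩ Lat2) := by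
    intro k hk
    apply subset_convexHull
    refine ⟨⟨⟨0, k, le_rfl, by positivity, by simp⟩, ?_⟩, by exact_mod_cast lat_smul hb k⟩
    simp only [Set.mem_singleton_iff, smul_eq_zero, not_or]
    exact ⟨hk, hb0⟩
  have hr0 : 0 < r := by linarith
  have e : p / r + q / r = 1 := by rw [← add_div]; exact div_self hr0.ne'
  have y1 := hc (m1 1 (by simp)) (m2 1 (by simp)) (div_nonneg hp hr0.le) (div_nonneg hq hr0.le) e
  have y2 := hc (m1 n hn0) (m2 n hn0) (div_nonneg hp hr0.le) (div_nonneg hq hr0.le) e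
  have hn1 : (0 : ℝ) < n - 1 := by linarith
  have := hc y1 y2 (a := (n - r) / (n - 1)) (b := (r - 1) / (n - 1))
    (div_nonneg (by linarith) hn1.le) (div_nonneg (by linarith) hn1.le)
    (by rw [← add_div]; rw [div_eq_one_iff_eq hn1.ne']; ring)
  convert this using 1
  ext j
  simp
  field_simp
  ring

lemma base_case {a b : Fin 2 → ℝ} (ha : a ∈ Lat2) (hb : b ∈ Lat2) (h : |dt a b| = 1) :
    2 * volume (subd a b) ≤ 1 := by
  refine le_trans ?_ (vol_tri h)
  gcongr
  rintro x ⟨⟨p, q, hp, hq, rfl⟩, hx⟩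
  refine ⟨p, q, hp, hq, ?_, rfl⟩
  by_contra hcon
  exact hx (hull_mem ha hb (by intro h0; simp [h0] at h) hp hq (not_lt.mp hcon))

lemma exists_pt {a b : Fin 2 → ℝ} (ha : a ∈ Lat2) (hb : b ∈ Lat2) (h : dt a b ≠ 0)
    (h1 : |dt a b| ≠ 1) : ∃ s t : ℝ, 0 ≤ s ∧ s < 1 ∧ 0 ≤ t ∧ t < 1 ∧ ¬ (s = 0 ∧ t = 0) ∧
      s • a + t • b ∈ Lat2 := by
  by_contra hcon
  push Not at hcon
  have key : ∀ x ∈ Lat2, ∃ m n : ℤ, x = (m : ℝ) • a + (n : ℝ) • b := by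
    intro x hx
    have hd := decomp h x
    set s := dt x b / dt a b
    set t := dt a x / dt a b
    refine ⟨⌊s⌋, ⌊t⌋, ?_⟩
    by_cases hz : Int.fract s = 0 ∧ Int.fract t = 0
    · have e1 := Int.floor_add_fract s
      have e2 := Int.floor_add_fract t
      rw [hz.1, add_zero] at e1
      rw [hz.2, add_zero] at e2
      rw [e1, e2]
      exact hd
    · exfalso
      refine hcon _ _ (Int.fract_nonneg s) (Int.fract_lt_one s) (Int.fract_nonneg t)
        (Int.fract_lt_one t) (fun h1 h2 => hz ⟨h1, h2⟩) ?_
      have := lat_sub hx (lat_add_s17 (lat_smul ha ⌊s⌋) (lat_smul hb ⌊t⌋))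
      convert this using 1
      rw [hd]
      simp only [Int.fract]
      module
  obtain ⟨m, n, e1⟩ := key ![1, 0] (by intro j; fin_cases j; exacts [⟨1, by simp⟩, ⟨0, by simp⟩])
  obtain ⟨m', n', e2⟩ := key ![0, 1] (by intro j; fin_cases j; exacts [⟨0, by simp⟩, ⟨1, by simp⟩])
  obtain ⟨z, hz⟩ := dt_int ha hb
  have a0 := congrFun e1 0
  have a1 := congrFun e1 1
  have b0 := congrFun e2 0
  have b1 := congrFun e2 1
  simp at a0 a1 b0 b1
  have hprod : ((m * n' - n * m' : ℤ) : ℝ) * (z : ℝ) = 1 := by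
    rw [← hz]
    unfold dt
    push_cast
    have : (m * a 0 + n * b 0) * (m' * a 1 + n' * b 1) - (m * a 1 + n * b 1) * (m' * a 0 + n' * b 0) = 1 := by
      rw [← a0, ← a1, ← b0, ← b1]; norm_num
    linear_combination this
  have hprod' : (m * n' - n * m') * z = 1 := by exact_mod_cast hprod
  have hu : IsUnit z := IsUnit.of_mul_eq_one_right _ hprod'
  rcases Int.isUnit_iff.mp hu with hu | hu <;> simp [hz, hu] at h1

lemma coneTwo_scale_right (a b : Fin 2 → ℝ) {t : ℝ} (ht : 0 < t) :
    coneTwo a (t • b) = coneTwo a b := by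
  ext x
  constructor
  · rintro ⟨p, q, hp, hq, rfl⟩
    exact ⟨p, q * t, hp, by positivity, by module⟩
  · rintro ⟨p, q, hp, hq, rfl⟩
    refine ⟨p, q / t, hp, by positivity, ?_⟩
    rw [smul_smul, div_mul_cancel₀ _ ht.ne']

lemma coneTwo_comm (a b : Fin 2 → ℝ) : coneTwo a b = coneTwo b a := by
  ext x
  constructor <;> rintro ⟨p, q, hp, hq, rfl⟩ <;> exact ⟨q, p, hq, hp, add_comm _ _⟩

lemma subd_comm (a b : Fin 2 → ℝ) : subd a b = subd b a := by
  unfold subd; rw [coneTwo_comm]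

lemma triPts_comm_sub (a b : Fin 2 → ℝ) : triPts a b ⊆ triPts b a := by
  rintro x ⟨hx, s, t, hs, ht, hst, rfl⟩
  exact ⟨hx, t, s, ht, hs, by linarith, add_comm _ _⟩

lemma triPts_comm (a b : Fin 2 → ℝ) : triPts a b = triPts b a :=
  Set.Subset.antisymm (triPts_comm_sub _ _) (triPts_comm_sub _ _)

lemma dt_comm (a b : Fin 2 → ℝ) : dt a b = - dt b a := by unfold dt; ring

lemma coneTwo_split {a b : Fin 2 → ℝ} {s t : ℝ} (hs : 0 < s) (ht : 0 < t) :
    coneTwo a b ⊆ coneTwo a (s • a + t • b) ∪ coneTwo (s • a + t • b) b := by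
  rintro x ⟨p, q, hp, hq, rfl⟩
  rcases le_total (q * s) (p * t) with h | h
  · left
    refine ⟨p - q * s / t, q / t, ?_, by positivity, ?_⟩
    · rw [sub_nonneg, div_le_iff₀ ht]; exact h
    · ext j; simp; field_simp; ring
  · right
    refine ⟨p / s, q - p * t / s, by positivity, ?_, ?_⟩
    · rw [sub_nonneg, div_le_iff₀ hs]; exact h
    · ext j; simp; field_simp; ring

lemma coneTwo_sub_left {a b : Fin 2 → ℝ} {s t : ℝ} (hs : 0 < s) (ht : 0 < t) :
    coneTwo a (s • a + t • b) ⊆ coneTwo a b := by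
  rintro x ⟨p, q, hp, hq, rfl⟩
  exact ⟨p + q * s, q * t, by positivity, by positivity, by module⟩

lemma coneTwo_sub_right {a b : Fin 2 → ℝ} {s t : ℝ} (hs : 0 < s) (ht : 0 < t) :
    coneTwo (s • a + t • b) b ⊆ coneTwo a b := by
  rintro x ⟨p, q, hp, hq, rfl⟩
  exact ⟨p * s, p * t + q, by positivity, by positivity, by module⟩

lemma subd_split {a b : Fin 2 → ℝ} {s t : ℝ} (hs : 0 < s) (ht : 0 < t) :
    subd a b ⊆ subd a (s • a + t • b) ∪ subd (s • a + t • b) b := by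
  rintro x ⟨hx, hn⟩
  rcases coneTwo_split hs ht hx with h | h
  · left
    refine ⟨h, fun hh => hn (convexHull_mono ?_ hh)⟩
    have := coneTwo_sub_left (a := a) (b := b) hs ht
    gcongr
  · right
    refine ⟨h, fun hh => hn (convexHull_mono ?_ hh)⟩
    have := coneTwo_sub_right (a := a) (b := b) hs ht
    gcongr

lemma triPts_split {a b : Fin 2 → ℝ} (h : dt a b ≠ 0) {s t : ℝ} (hs : 0 < s) (ht : 0 < t)
    (hst : s + t ≤ 1) (hc : s • a + t • b ∈ Lat2) :
    (triPts a (s • a + t • b)).ncard + (triPts (s • a + t • b) b).ncard + 1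
      ≤ (triPts a b).ncard := by
  set c := s • a + t • b with hcdef
  have d1 : Disjoint (triPts a c) (triPts c b) := by
    rw [Set.disjoint_left]
    rintro x ⟨_, p, q, hp, hq, hpq, rfl⟩ ⟨_, p', q', hp', hq', hpq', e⟩
    have e' : (p + q * s) • a + (q * t) • b = (p' * s) • a + (p' * t + q') • b := by
      rw [hcdef] at e
      convert e using 1 <;> module
    obtain ⟨e1, e2⟩ := decomp_unique h e'
    have : p * t + q' * s = 0 := by linear_combination t * e1 - s * e2
    have : 0 < p * t + q' * s := by positivity
    linarith
  have d2 : Disjoint (triPts a c ∪ triPts c b) {c} := by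
    rw [Set.disjoint_singleton_right]
    rintro (⟨_, p, q, hp, hq, hpq, e⟩ | ⟨_, p, q, hp, hq, hpq, e⟩)
    · have e' : s • a + t • b = (p + q * s) • a + (q * t) • b := by
        rw [hcdef] at e
        convert e using 1 <;> module
      obtain ⟨e1, e2⟩ := decomp_unique h e'
      have : q = 1 := by
        apply mul_right_cancel₀ ht.ne'; linarith
      linarith
    · have e' : s • a + t • b = (p * s) • a + (p * t + q) • b := by
        rw [hcdef] at e
        convert e using 1 <;> module
      obtain ⟨e1, e2⟩ := decomp_unique h e'
      have : p = 1 := by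
        apply mul_right_cancel₀ hs.ne'; linarith
      linarith
  rw [← Set.ncard_union_eq d1 (triPts_finite _ _) (triPts_finite _ _), ← Set.ncard_singleton c,
    ← Set.ncard_union_eq d2 ((triPts_finite _ _).union (triPts_finite _ _)) (Set.finite_singleton c)]
  apply Set.ncard_le_ncard _ (triPts_finite _ _)
  rintro x ((⟨hx, p, q, hp, hq, hpq, rfl⟩ | ⟨hx, p, q, hp, hq, hpq, rfl⟩) | hx)
  · refine ⟨hx, p + q * s, q * t, by positivity, by positivity, ?_, by rw [hcdef]; module⟩
    nlinarith
  · refine ⟨hx, p * s, p * t + q, by positivity, by positivity, ?_, by rw [hcdef]; module⟩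
    nlinarith
  · rw [Set.mem_singleton_iff] at hx
    subst hx
    exact ⟨hc, s, t, hs, ht, hst, hcdef⟩

lemma triPts_scale (a b : Fin 2 → ℝ) {t : ℝ} (ht : 0 < t) (ht1 : t < 1) :
    (triPts a (t • b)).ncard ≤ (triPts a b).ncard := by
  apply Set.ncard_le_ncard _ (triPts_finite _ _)
  rintro x ⟨hx, p, q, hp, hq, hpq, rfl⟩
  refine ⟨hx, p, q * t, hp, by positivity, ?_, by module⟩
  nlinarith

lemma step_le {a b : Fin 2 → ℝ} {n : ℕ} {t y : ℝ} {z : ℤ} (h : dt a b ≠ 0) (ht : 0 < t)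
    (ht1 : t < 1) (hn : |dt a b| ≤ (n + 1 : ℕ)) (hy : y = t * dt a b) (hz : y = z) :
    y ≠ 0 ∧ |y| ≤ n := by
  refine ⟨by rw [hy]; exact mul_ne_zero ht.ne' h, ?_⟩
  have h1 : |y| < (n + 1 : ℕ) := by
    rw [hy, abs_mul, abs_of_pos ht]
    have : 0 < |dt a b| := abs_pos.mpr h
    nlinarith
  rw [hz] at h1 ⊢
  have h2 : |z| < ((n + 1 : ℕ) : ℤ) := by exact_mod_cast h1
  have h3 : |z| ≤ (n : ℤ) := by push_cast at h2; omega
  exact_mod_cast h3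

lemma split_case {n : ℕ} (ih : ∀ a b : Fin 2 → ℝ, a ∈ Lat2 → b ∈ Lat2 → dt a b ≠ 0 →
      |dt a b| ≤ n → 2 * volume (subd a b) ≤ 1 + ((triPts a b).ncard : ENNReal))
    {a b : Fin 2 → ℝ} (ha : a ∈ Lat2) (hb : b ∈ Lat2) (h : dt a b ≠ 0)
    (hn : |dt a b| ≤ (n + 1 : ℕ)) {s t : ℝ} (hs : 0 < s) (ht : 0 < t)
    (hst : s + t ≤ 1) (hc : s • a + t • b ∈ Lat2) :
    2 * volume (subd a b) ≤ 1 + ((triPts a b).ncard : ENNReal) := by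
  have e1 : dt a (s • a + t • b) = t * dt a b := by simp [dt]; ring
  have e2 : dt (s • a + t • b) b = s * dt a b := by simp [dt]; ring
  obtain ⟨z1, hz1⟩ := dt_int ha hc
  obtain ⟨z2, hz2⟩ := dt_int hc hb
  obtain ⟨f1, f2⟩ := step_le h ht (by linarith) hn e1 hz1
  obtain ⟨g1, g2⟩ := step_le h hs (by linarith) hn e2 hz2
  have i1 := ih _ _ ha hc f1 f2
  have i2 := ih _ _ hc hb g1 g2
  have hN := triPts_split h hs ht hst hc
  calc 2 * volume (subd a b)
      ≤ 2 * (volume (subd a (s • a + t • b)) + volume (subd (s • a + t • b) b)) := by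
        gcongr
        exact (measure_mono (subd_split hs ht)).trans (measure_union_le _ _)
    _ = 2 * volume (subd a (s • a + t • b)) + 2 * volume (subd (s • a + t • b) b) := mul_add _ _ _
    _ ≤ (1 + ((triPts a (s • a + t • b)).ncard : ENNReal)) +
        (1 + ((triPts (s • a + t • b) b).ncard : ENNReal)) := add_le_add i1 i2
    _ = 1 + (((triPts a (s • a + t • b)).ncard + (triPts (s • a + t • b) b).ncard + 1 : ℕ) : ENNReal) := by
        push_cast; ring
    _ ≤ _ := by gcongr

lemma scale_case {n : ℕ} (ih : ∀ a b : Fin 2 → ℝ, a ∈ Lat2 → b ∈ Lat2 → dt a b ≠ 0 →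
      |dt a b| ≤ n → 2 * volume (subd a b) ≤ 1 + ((triPts a b).ncard : ENNReal))
    {a b : Fin 2 → ℝ} (ha : a ∈ Lat2) (h : dt a b ≠ 0)
    (hn : |dt a b| ≤ (n + 1 : ℕ)) {t : ℝ} (ht : 0 < t)
    (ht1 : t < 1) (hc : t • b ∈ Lat2) :
    2 * volume (subd a b) ≤ 1 + ((triPts a b).ncard : ENNReal) := by
  have e1 : dt a (t • b) = t * dt a b := by simp [dt]; ring
  obtain ⟨z1, hz1⟩ := dt_int ha hc
  obtain ⟨f1, f2⟩ := step_le h ht ht1 hn e1 hz1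
  have i1 := ih _ _ ha hc f1 f2
  have : subd a (t • b) = subd a b := by unfold subd; rw [coneTwo_scale_right _ _ ht]
  rw [this] at i1
  refine i1.trans ?_
  gcongr 1 + ?_
  exact_mod_cast triPts_scale a b ht ht1

lemma main_bound_s17 (n : ℕ) : ∀ a b : Fin 2 → ℝ, a ∈ Lat2 → b ∈ Lat2 → dt a b ≠ 0 →
    |dt a b| ≤ n → 2 * volume (subd a b) ≤ 1 + ((triPts a b).ncard : ENNReal) := by
  induction n with
  | zero =>
    intro a b _ _ h hn
    exfalso
    apply h
    simpa using hn
  | succ n ih =>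
    intro a b ha hb h hn
    by_cases h1 : |dt a b| = 1
    · exact (base_case ha hb h1).trans le_self_add
    obtain ⟨s, t, hs, hs1, ht, ht1, hne, hc⟩ := exists_pt ha hb h h1
    rcases hs.eq_or_lt with rfl | hs
    · have ht' : 0 < t := lt_of_le_of_ne ht (fun e => hne ⟨rfl, e.symm⟩)
      exact scale_case ih ha h hn ht' ht1 (by simpa using hc)
    rcases ht.eq_or_lt with rfl | ht
    · rw [subd_comm, triPts_comm]
      exact scale_case ih hb (by rw [dt_comm]; simpa using h)
        (by rw [dt_comm, abs_neg]; exact hn) hs hs1 (by simpa using hc)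
    rcases le_total (s + t) 1 with hst | hst
    · exact split_case ih ha hb h hn hs ht hst hc
    · refine split_case ih ha hb h hn (s := 1 - s) (t := 1 - t) (by linarith) (by linarith)
        (by linarith) ?_
      have := lat_sub (lat_add_s17 ha hb) hc
      convert this using 1
      module

lemma rsv_bound {a b : Fin 2 → ℝ} (ha : a ∈ Lat2) (hb : b ∈ Lat2) (h : dt a b ≠ 0) :
    RSV (coneTwo a b) ≤ 1 + ((triPts a b).ncard : ℝ) := by
  obtain ⟨n, hn⟩ := exists_nat_ge |dt a b|
  have := ENNReal.toReal_mono (by simp) (main_bound_s17 n a b ha hb h hn)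
  rw [ENNReal.toReal_mul, ENNReal.toReal_add (by simp) (by simp)] at this
  simpa [RSV, subd] using this

def edgePts (B : AffineBasis (Fin 3) ℝ (Fin 2 → ℝ)) (i : Fin 3) : Set (Fin 2 → ℝ) :=
  {x | x ∈ Lat2 ∧ B.coord i x = 0 ∧ ∀ l, l ≠ i → 0 < B.coord l x}

lemma sum_three {M : Type*} [AddCommMonoid M] {i j k : Fin 3} (hij : i ≠ j) (hik : i ≠ k)
    (hjk : j ≠ k) (f : Fin 3 → M) : ∑ l, f l = f i + f j + f k := by
  have : (Finset.univ : Finset (Fin 3)) = {i, j, k} := by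
    revert i j k; decide
  rw [this, Finset.sum_insert (by simp [hij, hik]), Finset.sum_pair hjk, add_assoc]

lemma coord_lin (B : AffineBasis (Fin 3) ℝ (Fin 2 → ℝ)) (l i j : Fin 3) :
    (B.coord l).linear (B j - B i) = B.coord l (B j) - B.coord l (B i) := by
  have := (B.coord l).linearMap_vsub (B j) (B i)
  simpa using this

lemma coord_shift (B : AffineBasis (Fin 3) ℝ (Fin 2 → ℝ)) (l i j k : Fin 3) (s t : ℝ) :
    B.coord l (s • (B j - B i) + t • (B k - B i) + B i) =
      s * (B.coord l (B j) - B.coord l (B i)) + t * (B.coord l (B k) - B.coord l (B i))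
        + B.coord l (B i) := by
  have := (B.coord l).map_vadd (B i) (s • (B j - B i) + t • (B k - B i))
  simp only [vadd_eq_add] at this
  rw [this, map_add, map_smul, map_smul, coord_lin, coord_lin]
  simp

lemma coneAt_eq (B : AffineBasis (Fin 3) ℝ (Fin 2 → ℝ)) {i j k : Fin 3} (hij : i ≠ j)
    (hik : i ≠ k) (hjk : j ≠ k) :
    coneAt (convexHull ℝ (Set.range B)) (B i) = coneTwo (B j - B i) (B k - B i) := by
  ext x
  constructor
  · rintro ⟨t, ht, p, hp, rfl⟩
    rw [B.convexHull_eq_nonneg_coord] at hp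
    have e := B.linear_combination_coord_eq_self p
    have e1 := B.sum_coord_apply_eq_one p
    rw [sum_three hij hik hjk] at e e1
    refine ⟨t * B.coord j p, t * B.coord k p, mul_nonneg ht (hp j), mul_nonneg ht (hp k), ?_⟩
    have e2 : B.coord i p = 1 - B.coord j p - B.coord k p := by linarith
    rw [e2] at e
    conv_lhs => rw [← e]
    module
  · rintro ⟨p, q, hp, hq, rfl⟩
    have hm : ∀ l, B l ∈ convexHull ℝ (Set.range B) := fun l =>
      subset_convexHull _ _ (Set.mem_range_self l)
    rcases (add_nonneg hp hq).eq_or_lt with h | h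
    · have hp0 : p = 0 := by linarith
      have hq0 : q = 0 := by linarith
      exact ⟨0, le_rfl, B i, hm i, by simp [hp0, hq0]⟩
    · refine ⟨p + q, h.le, _, convex_convexHull ℝ _ (hm j) (hm k) (div_nonneg hp h.le)
        (div_nonneg hq h.le) (by rw [← add_div]; exact div_self h.ne'), ?_⟩
      ext m
      simp
      field_simp
      ring

lemma dt_ne (B : AffineBasis (Fin 3) ℝ (Fin 2 → ℝ)) {i j k : Fin 3} (hij : i ≠ j)
    (hik : i ≠ k) (hjk : j ≠ k) : dt (B j - B i) (B k - B i) ≠ 0 := by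
  intro h
  have f1 : (B.coord j).linear (B j - B i) = 1 := by
    rw [coord_lin, B.coord_apply_eq, B.coord_apply_ne hij.symm, sub_zero]
  have f2 : (B.coord j).linear (B k - B i) = 0 := by
    rw [coord_lin, B.coord_apply_ne hjk, B.coord_apply_ne hij.symm, sub_zero]
  have f3 : (B.coord k).linear (B k - B i) = 1 := by
    rw [coord_lin, B.coord_apply_eq, B.coord_apply_ne hik.symm, sub_zero]
  generalize B j - B i = u at *
  generalize B k - B i = w at *
  unfold dt at h
  have g : ∀ m, w m = 0 := by
    intro m
    have e : w m • u = u m • w := by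
      ext l
      fin_cases m <;> fin_cases l <;> simp <;> linarith
    have := congrArg (B.coord j).linear e
    rw [map_smul, map_smul, f1, f2] at this
    simpa using this
  have : w = 0 := funext g
  rw [this, map_zero] at f3
  exact zero_ne_one f3

lemma hull_bdd (B : AffineBasis (Fin 3) ℝ (Fin 2 → ℝ)) :
    Bornology.IsBounded (convexHull ℝ (Set.range B)) := by
  rw [isBounded_convexHull]
  exact (Set.finite_range _).isBounded

lemma edgePts_sub (B : AffineBasis (Fin 3) ℝ (Fin 2 → ℝ)) (i : Fin 3) :
    edgePts B i ⊆ frontier (convexHull ℝ (Set.range B)) ∩ Lat2 := by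
  rintro x ⟨hx, h0, h1⟩
  refine ⟨?_, hx⟩
  rw [((Set.finite_range B).isClosed_convexHull ℝ).frontier_eq, B.interior_convexHull,
    B.convexHull_eq_nonneg_coord]
  refine ⟨fun l => ?_, fun h => ?_⟩
  · by_cases hl : l = i
    · rw [hl, h0]
    · exact (h1 l hl).le
  · have := h i
    rw [h0] at this
    exact lt_irrefl _ this

lemma frontier_fin (B : AffineBasis (Fin 3) ℝ (Fin 2 → ℝ)) :
    (frontier (convexHull ℝ (Set.range B)) ∩ Lat2).Finite := by
  apply lat_finite_of_bounded
  refine (hull_bdd B).subset ?_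
  rw [((Set.finite_range B).isClosed_convexHull ℝ).frontier_eq]
  exact Set.sdiff_subset

lemma edgePts_fin (B : AffineBasis (Fin 3) ℝ (Fin 2 → ℝ)) (i : Fin 3) : (edgePts B i).Finite :=
  (frontier_fin B).subset (edgePts_sub B i)

lemma vertex_bound (B : AffineBasis (Fin 3) ℝ (Fin 2 → ℝ)) (hB : ∀ l, B l ∈ Lat2)
    {i j k : Fin 3} (hij : i ≠ j) (hik : i ≠ k) (hjk : j ≠ k) :
    RSV (coneAt (convexHull ℝ (Set.range B)) (B i)) ≤
      1 + ((interior (convexHull ℝ (Set.range B)) ∩ Lat2).ncard : ℝ)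
        + ((edgePts B i).ncard : ℝ) := by
  rw [coneAt_eq B hij hik hjk]
  refine (rsv_bound (lat_sub (hB j) (hB i)) (lat_sub (hB k) (hB i)) (dt_ne B hij hik hjk)).trans ?_
  rw [add_assoc]
  gcongr
  have hfin : (interior (convexHull ℝ (Set.range B)) ∩ Lat2).Finite :=
    lat_finite_of_bounded ((hull_bdd B).subset interior_subset)
  have key : (triPts (B j - B i) (B k - B i)).ncard ≤
      ((interior (convexHull ℝ (Set.range B)) ∩ Lat2) ∪ edgePts B i).ncard := by
    refine Set.ncard_le_ncard_of_injOn (fun x => x + B i) ?_ ((add_left_injective (B i)).injOn)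
      (hfin.union (edgePts_fin B i))
    rintro x ⟨hx, s, t, hs, ht, hst, rfl⟩
    have hl : s • (B j - B i) + t • (B k - B i) + B i ∈ Lat2 := lat_add_s17 hx (hB i)
    have ci : B.coord i (s • (B j - B i) + t • (B k - B i) + B i) = 1 - s - t := by
      rw [coord_shift, B.coord_apply_eq, B.coord_apply_ne hij, B.coord_apply_ne hik]; ring
    have cj : B.coord j (s • (B j - B i) + t • (B k - B i) + B i) = s := by
      rw [coord_shift, B.coord_apply_eq, B.coord_apply_ne hij.symm, B.coord_apply_ne hjk]; ring
    have ck : B.coord k (s • (B j - B i) + t • (B k - B i) + B i) = t := by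
      rw [coord_shift, B.coord_apply_eq, B.coord_apply_ne hik.symm, B.coord_apply_ne hjk.symm]; ring
    have hall : ∀ l : Fin 3, l = i ∨ l = j ∨ l = k := by
      clear * - hij hik hjk; revert i j k; decide
    rcases hst.eq_or_lt with h | h
    · right
      refine ⟨hl, by rw [ci]; linarith, ?_⟩
      intro l hli
      rcases hall l with rfl | rfl | rfl
      · exact absurd rfl hli
      · rw [cj]; exact hs
      · rw [ck]; exact ht
    · left
      refine ⟨?_, hl⟩
      rw [B.interior_convexHull]
      intro l
      rcases hall l with rfl | rfl | rfl
      · rw [ci]; linarith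
      · rw [cj]; exact hs
      · rw [ck]; exact ht
  exact_mod_cast key.trans (Set.ncard_union_le _ _)

lemma edge_disj (B : AffineBasis (Fin 3) ℝ (Fin 2 → ℝ)) {i j : Fin 3} (hij : i ≠ j) :
    Disjoint (edgePts B i) (edgePts B j) := by
  rw [Set.disjoint_left]
  rintro x ⟨_, h0, _⟩ ⟨_, _, h1⟩
  have := h1 i hij
  rw [h0] at this
  exact lt_irrefl _ this

lemma edge_disj_vert (B : AffineBasis (Fin 3) ℝ (Fin 2 → ℝ)) (i : Fin 3) :
    Disjoint (edgePts B i) (Set.range B) := by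
  rw [Set.disjoint_left]
  rintro x ⟨_, h0, h1⟩ ⟨l, rfl⟩
  obtain ⟨m, hmi, hml⟩ : ∃ m : Fin 3, m ≠ i ∧ m ≠ l := by
    clear * -; revert i l; decide
  have := h1 m hmi
  rw [B.coord_apply_ne hml] at this
  exact lt_irrefl _ this

lemma vert_sub (B : AffineBasis (Fin 3) ℝ (Fin 2 → ℝ)) (hB : ∀ l, B l ∈ Lat2) :
    Set.range B ⊆ frontier (convexHull ℝ (Set.range B)) ∩ Lat2 := by
  rintro x ⟨l, rfl⟩
  refine ⟨?_, hB l⟩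
  rw [((Set.finite_range B).isClosed_convexHull ℝ).frontier_eq]
  refine ⟨subset_convexHull _ _ (Set.mem_range_self l), fun h => ?_⟩
  rw [B.interior_convexHull] at h
  obtain ⟨m, hml⟩ : ∃ m : Fin 3, m ≠ l := exists_ne l
  have := h m
  rw [B.coord_apply_ne hml] at this
  exact lt_irrefl _ this

lemma boundary_count (B : AffineBasis (Fin 3) ℝ (Fin 2 → ℝ)) (hB : ∀ l, B l ∈ Lat2) :
    (edgePts B 0).ncard + (edgePts B 1).ncard + (edgePts B 2).ncard + 3 ≤
      (frontier (convexHull ℝ (Set.range B)) ∩ Lat2).ncard := by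
  have h3 : (Set.range B).ncard = 3 := by
    rw [← Set.image_univ, Set.ncard_image_of_injective _ B.ind.injective]
    simp [Set.ncard_univ]
  have f := edgePts_fin B
  refine le_of_eq_of_le (congrArg (fun n => _ + n) h3.symm) ?_
  rw [← Set.ncard_union_eq (edge_disj B (by decide)) (f 0) (f 1),
    ← Set.ncard_union_eq _ ((f 0).union (f 1)) (f 2),
    ← Set.ncard_union_eq _ (((f 0).union (f 1)).union (f 2)) (Set.finite_range _)]
  · apply Set.ncard_le_ncard _ (frontier_fin B)
    simp only [Set.union_subset_iff]
    exact ⟨⟨⟨edgePts_sub B 0, edgePts_sub B 1⟩, edgePts_sub B 2⟩, vert_sub B hB⟩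
  · simp only [Set.disjoint_union_left]
    exact ⟨⟨edge_disj_vert B 0, edge_disj_vert B 1⟩, edge_disj_vert B 2⟩
  · simp only [Set.disjoint_union_left]
    exact ⟨edge_disj B (by decide), edge_disj B (by decide)⟩

/-- for a 2-dimensional lattice triangle `P` with `i` interior and `b`
boundary lattice points, the sum over the vertices `v` of the normalized relative
subdiagram volumes of the vertex cones `Cone(P − v)` is at most `3i + b`. -/
theorem triangle_rsv_sum_bound (v₀ v₁ v₂ : Fin 2 → ℝ)
    (h0 : v₀ ∈ Lat2) (h1 : v₁ ∈ Lat2) (h2 : v₂ ∈ Lat2)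
    (hind : AffineIndependent ℝ ![v₀, v₁, v₂]) :
    RSV (coneAt (convexHull ℝ ({v₀, v₁, v₂} : Set (Fin 2 → ℝ))) v₀)
        + RSV (coneAt (convexHull ℝ ({v₀, v₁, v₂} : Set (Fin 2 → ℝ))) v₁)
        + RSV (coneAt (convexHull ℝ ({v₀, v₁, v₂} : Set (Fin 2 → ℝ))) v₂)
      ≤ 3 * ((interior (convexHull ℝ ({v₀, v₁, v₂} : Set (Fin 2 → ℝ))) ∩ Lat2).ncard : ℝ)
        + ((frontier (convexHull ℝ ({v₀, v₁, v₂} : Set (Fin 2 → ℝ))) ∩ Lat2).ncard : ℝ) := by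

  have htop : affineSpan ℝ (Set.range ![v₀, v₁, v₂]) = ⊤ := by
    rw [hind.affineSpan_eq_top_iff_card_eq_finrank_add_one]
    simp
  let B : AffineBasis (Fin 3) ℝ (Fin 2 → ℝ) := ⟨![v₀, v₁, v₂], hind, htop⟩
  have e0 : B 0 = v₀ := rfl
  have e1 : B 1 = v₁ := rfl
  have e2 : B 2 = v₂ := rfl
  have hB : ∀ l, B l ∈ Lat2 := by
    intro l
    fin_cases l
    exacts [h0, h1, h2]
  have hr : ({v₀, v₁, v₂} : Set (Fin 2 → ℝ)) = Set.range B := by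
    ext x
    constructor
    · rintro (rfl | rfl | rfl)
      exacts [⟨0, rfl⟩, ⟨1, rfl⟩, ⟨2, rfl⟩]
    · rintro ⟨l, rfl⟩
      fin_cases l
      exacts [Or.inl rfl, Or.inr (Or.inl rfl), Or.inr (Or.inr rfl)]
  rw [hr]
  have b0 := vertex_bound B hB (i := 0) (j := 1) (k := 2) (by decide) (by decide) (by decide)
  have b1 := vertex_bound B hB (i := 1) (j := 0) (k := 2) (by decide) (by decide) (by decide)
  have b2 := vertex_bound B hB (i := 2) (j := 0) (k := 1) (by decide) (by decide) (by decide)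
  rw [e0] at b0
  rw [e1] at b1
  rw [e2] at b2
  have hc : (((edgePts B 0).ncard + (edgePts B 1).ncard + (edgePts B 2).ncard + 3 : ℕ) : ℝ) ≤
      ((frontier (convexHull ℝ (Set.range B)) ∩ Lat2).ncard : ℝ) := by
    exact_mod_cast boundary_count B hB
  push_cast at hc
  linarith
end
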